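/- There exists a constant C > 0 with the following property. Let s and D be positive integers with s odd, s ≥ 3D, and s/(D·log D) ≥ C (with the convention that this holds automatically when D = 1). Then the number of odd integers i with 3 ≤ i ≤ s such that ζ(i) is irrational is at least the number of positive divisors of D. -/

import Mathlib

/-- The Riemann zeta value `ζ(i) = ∑_{m ≥ 1} 1/m^i`, as a real number. -/
noncomputable def zetaVal (i : ℕ) : ℝ := ∑' m : ℕ, 1 / ((m : ℝ) + 1) ^ i

section

open Finset Filter Topology

theorem log_factorial_eq_sum_vonMangoldt {n N : ℕ} (h : n ≤ N) :
    Real.log (n.factorial : ℝ) =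
      ∑ d ∈ Ioc 0 N, ArithmeticFunction.vonMangoldt d * ((n / d : ℕ) : ℝ) := by
  induction n with
  | zero => simp
  | succ n ih =>
    rw [Nat.factorial_succ, Nat.cast_mul, Real.log_mul (by positivity) (by positivity),
      ih (by omega), ← ArithmeticFunction.vonMangoldt_sum]
    have h1 : (n + 1).divisors = (Ioc 0 N).filter (· ∣ n + 1) := by
      ext d
      simp only [Nat.mem_divisors, mem_filter, mem_Ioc]
      constructor
      · rintro ⟨hd, -⟩
        exact ⟨⟨Nat.pos_of_dvd_of_pos hd (by omega), (Nat.le_of_dvd (by omega) hd).trans h⟩, hd⟩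
      · rintro ⟨-, hd⟩
        exact ⟨hd, by omega⟩
    rw [h1, sum_filter, ← sum_add_distrib]
    refine sum_congr rfl fun d _ => ?_
    rw [Nat.succ_div]
    split_ifs <;> push_cast <;> ring

theorem psi_sub_psi_div_le (n : ℕ) :
    Chebyshev.psi n - Chebyshev.psi (n / 42 : ℕ) ≤
      Real.log (n.factorial : ℝ) - Real.log ((n / 2).factorial : ℝ)
        - Real.log ((n / 3).factorial : ℝ) - Real.log ((n / 7).factorial : ℝ)
        - Real.log ((n / 42).factorial : ℝ) := by
  rw [log_factorial_eq_sum_vonMangoldt le_rfl,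
    log_factorial_eq_sum_vonMangoldt (Nat.div_le_self n 2),
    log_factorial_eq_sum_vonMangoldt (Nat.div_le_self n 3),
    log_factorial_eq_sum_vonMangoldt (Nat.div_le_self n 7),
    log_factorial_eq_sum_vonMangoldt (Nat.div_le_self n 42)]
  have h1 : Chebyshev.psi (n / 42 : ℕ) =
      ∑ d ∈ Ioc 0 n, if d ≤ n / 42 then ArithmeticFunction.vonMangoldt d else 0 := by
    rw [Chebyshev.psi, ← sum_filter, Nat.floor_natCast]
    refine sum_congr ?_ fun _ _ => rfl
    ext d
    simp only [mem_Ioc, mem_filter]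
    omega
  rw [h1, Chebyshev.psi, Nat.floor_natCast]
  simp only [← sum_sub_distrib]
  refine sum_le_sum fun d hd => ?_
  have hd0 : 0 < d := (mem_Ioc.1 hd).1
  have hL : 0 ≤ ArithmeticFunction.vonMangoldt d := ArithmeticFunction.vonMangoldt_nonneg
  have hc : ∀ a : ℕ, n / a / d = n / d / a := fun a => by
    rw [Nat.div_div_eq_div_mul, Nat.div_div_eq_div_mul, mul_comm]
  rw [hc, hc, hc, hc]
  have hm : 1 ≤ n / d := (Nat.one_le_div_iff hd0).2 (mem_Ioc.1 hd).2
  have h42 : d ≤ n / 42 ↔ 42 ≤ n / d := by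
    rw [Nat.le_div_iff_mul_le (by norm_num), Nat.le_div_iff_mul_le hd0, mul_comm]
  set m := n / d
  rw [← mul_sub, ← mul_sub, ← mul_sub, ← mul_sub]
  split_ifs with h
  · have : m / 2 + m / 3 + m / 7 + m / 42 ≤ m := by omega
    have : ((m / 2 : ℕ) : ℝ) + (m / 3 : ℕ) + (m / 7 : ℕ) + (m / 42 : ℕ) ≤ m := by
        exact_mod_cast this
    rw [sub_self]
    exact mul_nonneg hL (by linarith)
  · have : m / 2 + m / 3 + m / 7 + m / 42 + 1 ≤ m := by
      rw [h42] at h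
      omega
    have : ((m / 2 : ℕ) : ℝ) + (m / 3 : ℕ) + (m / 7 : ℕ) + (m / 42 : ℕ) + 1 ≤ m := by
      exact_mod_cast this
    rw [sub_zero]
    exact le_mul_of_one_le_right hL (by linarith)

theorem log_factorial_le_mul_log {n : ℕ} (hn : 0 < n) :
    Real.log (n.factorial : ℝ) ≤ n * Real.log n - n + Real.log n + 1 := by
  induction n, hn using Nat.le_induction with
  | base => simp
  | succ n hn ih =>
    have hn' : (0 : ℝ) < n := by exact_mod_cast hn
    rw [Nat.factorial_succ, Nat.cast_mul, Real.log_mul (by positivity) (by positivity)]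
    push_cast
    have h := Real.one_sub_inv_le_log_of_pos (x := ((n : ℝ) + 1) / n) (by positivity)
    rw [Real.log_div (by positivity) (by positivity)] at h
    have h2 : (1 - (((n : ℝ) + 1) / n)⁻¹) * (n + 1) = 1 := by field_simp; ring
    nlinarith [mul_le_mul_of_nonneg_right h (by positivity : (0 : ℝ) ≤ n + 1)]

theorem mul_log_sub_le_log_factorial {k : ℕ} {x : ℝ} (hx : 1 ≤ x) (hk : x ≤ k + 1) :
    x * Real.log x - x - Real.log (k + 1) ≤ Real.log (k.factorial : ℝ) := by
  have h1 : ((k + 1 : ℕ) : ℝ) * Real.log (k + 1 : ℕ) - (k + 1 : ℕ) ≤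
      Real.log ((k + 1).factorial : ℝ) := by
    have := Stirling.le_log_factorial_stirling (n := k + 1) (by omega)
    have h2 : 0 ≤ Real.log ((k + 1 : ℕ) : ℝ) := Real.log_natCast_nonneg _
    have h3 : 0 ≤ Real.log (2 * Real.pi) := Real.log_nonneg (by linarith [Real.pi_gt_three])
    linarith
  rw [Nat.factorial_succ, Nat.cast_mul, Real.log_mul (by positivity) (by positivity)] at h1
  push_cast at h1
  set y : ℝ := (k : ℝ) + 1
  have h2 : x * Real.log x - x ≤ y * Real.log y - y := by
    have hx0 : 0 < x := by linarith
    have hy0 : 0 < y := by linarith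
    have h3 := Real.one_sub_inv_le_log_of_pos (x := y / x) (by positivity)
    rw [Real.log_div (by positivity) (by positivity)] at h3
    have h4 : (1 - (y / x)⁻¹) * y = y - x := by field_simp
    have h5 := Real.log_nonneg hx
    nlinarith [mul_le_mul_of_nonneg_right h3 hy0.le]
  linarith

theorem psi_sub_psi_div_le_mul_add_log {n : ℕ} (hn : 42 ≤ n) :
    Chebyshev.psi n - Chebyshev.psi (n / 42 : ℕ) ≤
      n * (Real.log 2 / 2 + Real.log 3 / 3 + Real.log 7 / 7 + Real.log 42 / 42)
        + (5 * Real.log (n + 1) + 1) := by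
  have hn' : (42 : ℝ) ≤ n := by exact_mod_cast hn
  have key : ∀ a : ℕ, 0 < a → a ≤ 42 → (n / a : ℝ) * (Real.log n - Real.log a) - n / a
      - Real.log (n + 1) ≤ Real.log ((n / a).factorial : ℝ) := by
    intro a ha ha'
    have ha0 : (0 : ℝ) < a := by exact_mod_cast ha
    have ha1 : (a : ℝ) ≤ 42 := by exact_mod_cast ha'
    have h1 : (n / a : ℝ) ≤ (n / a : ℕ) + 1 := by
      rw [← Nat.floor_div_eq_div (K := ℝ)]
      exact (Nat.lt_floor_add_one _).le
    have h2 := mul_log_sub_le_log_factorial (k := n / a) (x := n / a)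
      (by rw [le_div_iff₀ ha0]; linarith) h1
    rw [Real.log_div (by linarith) (by linarith)] at h2
    have h3 : Real.log ((n / a : ℕ) + 1) ≤ Real.log (n + 1) := by
      apply Real.log_le_log (by positivity)
      have : ((n / a : ℕ) : ℝ) ≤ n := by exact_mod_cast Nat.div_le_self n a
      linarith
    linarith
  have h0 := psi_sub_psi_div_le n
  have h1 := log_factorial_le_mul_log (n := n) (by omega)
  have h2 := key 2 (by norm_num) (by norm_num)
  have h3 := key 3 (by norm_num) (by norm_num)
  have h7 := key 7 (by norm_num) (by norm_num)
  have h42 := key 42 (by norm_num) (by norm_num)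
  have hl : Real.log n ≤ Real.log (n + 1) := Real.log_le_log (by linarith) (by linarith)
  push_cast at h2 h3 h7 h42
  linarith

theorem exists_psi_le : ∃ B : ℝ, ∀ n : ℕ, Chebyshev.psi n ≤ n * Real.log 3.1 + B := by
  set c := Real.log 2 / 2 + Real.log 3 / 3 + Real.log 7 / 7 + Real.log 42 / 42 with hc
  have hc' : c < 41 / 42 * Real.log 3.1 := by
    have h : Real.log ((2 : ℝ) ^ 22 * 3 ^ 15 * 7 ^ 7) < Real.log (3.1 ^ 41) :=
      Real.log_lt_log (by norm_num) (by norm_num)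
    rw [Real.log_mul (by norm_num) (by norm_num), Real.log_mul (by norm_num) (by norm_num),
      Real.log_pow, Real.log_pow, Real.log_pow, Real.log_pow] at h
    have h42 : Real.log 42 = Real.log 2 + Real.log 3 + Real.log 7 := by
      rw [← Real.log_mul (by norm_num) (by norm_num), ← Real.log_mul (by norm_num) (by norm_num)]
      norm_num
    rw [hc, h42]
    push_cast at h
    linarith
  set ε := 41 / 42 * Real.log 3.1 - c
  have hε : 0 < ε := by simp only [ε]; linarith
  have hlim : ∀ᶠ n : ℕ in atTop, 5 * Real.log ((n : ℝ) + 1) + 1 ≤ ε * n := by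
    have h1 : (fun x : ℝ => Real.log x) =o[atTop] fun x => x := Real.isLittleO_log_id_atTop
    have h2 : Tendsto (fun n : ℕ => (n : ℝ) + 1) atTop atTop :=
      tendsto_atTop_add_const_right _ _ tendsto_natCast_atTop_atTop
    have h3 := (h1.comp_tendsto h2).def (c := ε / 10) (by positivity)
    filter_upwards [h3, eventually_ge_atTop ⌈(2 + ε) / ε⌉₊] with n hn hn2
    simp only [Function.comp, Real.norm_eq_abs] at hn
    have h4 : (2 + ε) / ε ≤ n := (Nat.le_ceil _).trans (by exact_mod_cast hn2)
    rw [div_le_iff₀ hε] at h4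
    rw [abs_of_nonneg (by positivity : (0 : ℝ) ≤ (n : ℝ) + 1)] at hn
    have := le_abs_self (Real.log ((n : ℝ) + 1))
    linarith
  obtain ⟨N, hN⟩ := eventually_atTop.1 hlim
  refine ⟨Chebyshev.psi (N + 42 : ℕ), fun n => ?_⟩
  have hL : 0 ≤ Real.log 3.1 := Real.log_nonneg (by norm_num)
  induction n using Nat.strong_induction_on with
  | _ n ih =>
    rcases le_total n (N + 42) with h | h
    · have h1 : Chebyshev.psi n ≤ Chebyshev.psi (N + 42 : ℕ) :=
        Chebyshev.psi_mono (by exact_mod_cast h)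
      have : 0 ≤ (n : ℝ) * Real.log 3.1 := by positivity
      linarith
    · have h1 := ih (n / 42) (Nat.div_lt_self (by omega) (by norm_num))
      have h2 := psi_sub_psi_div_le_mul_add_log (n := n) (by omega)
      have h3 := hN n (by omega)
      have h4 : ((n / 42 : ℕ) : ℝ) ≤ n / 42 := by exact_mod_cast Nat.cast_div_le
      have h5 := mul_le_mul_of_nonneg_right h4 hL
      simp only [ε] at h3
      rw [← hc] at h2
      linarith

theorem exists_lcmUpto_le :
    ∃ K : ℝ, 0 < K ∧ ∀ n : ℕ, (Nat.lcmUpto n : ℝ) ≤ K * 3.1 ^ n := by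
  obtain ⟨B, hB⟩ := exists_psi_le
  refine ⟨Real.exp B, Real.exp_pos B, fun n => ?_⟩
  have h := hB n
  rw [Chebyshev.psi_eq_log_lcmUpto,
    Real.log_le_iff_le_exp (by exact_mod_cast Nat.lcmUpto_pos n), Real.exp_add,
    Real.exp_nat_mul, Real.exp_log (by norm_num)] at h
  linarith

/-- The product of binomials `C(n,k) C(n+k,k)` whose square is the summand of the Apéry numbers. -/
noncomputable def aperyLam (n k : ℕ) : ℝ := (n.choose k : ℝ) * ((n + k).choose k : ℝ)

theorem aperyLam_zero (n : ℕ) : aperyLam n 0 = 1 := by simp [aperyLam]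

theorem aperyLam_eq_zero {n k : ℕ} (h : n < k) : aperyLam n k = 0 := by
  simp [aperyLam, Nat.choose_eq_zero_of_lt h]

theorem aperyLam_pos {n k : ℕ} (h : k ≤ n) : 0 < aperyLam n k := by
  have h1 : 0 < n.choose k := Nat.choose_pos h
  have h2 : 0 < (n + k).choose k := Nat.choose_pos (by omega)
  unfold aperyLam
  positivity

theorem aperyLam_nonneg (n k : ℕ) : 0 ≤ aperyLam n k := by unfold aperyLam; positivity

theorem aperyLam_succ_left (n k : ℕ) :
    aperyLam (n + 1) k * ((n : ℝ) + 1 - k) = ((n : ℝ) + 1 + k) * aperyLam n k := by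
  rcases lt_or_ge (n + 1) k with h | h
  · rw [aperyLam_eq_zero h, aperyLam_eq_zero (by omega)]; ring
  have h1 : ((n + 1).choose k : ℝ) * ((n : ℝ) + 1 - k) = n.choose k * (n + 1) := by
    have := Nat.choose_mul_succ_eq n k
    have h2 : ((n.choose k * (n + 1) : ℕ) : ℝ) = (((n + 1).choose k * (n + 1 - k) : ℕ) : ℝ) := by
      exact_mod_cast this
    push_cast [Nat.cast_sub h] at h2
    linarith
  have h2 : ((n + 1 + k).choose k : ℝ) * ((n : ℝ) + 1) = (n + k).choose k * (n + 1 + k) := by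
    have := Nat.choose_mul_succ_eq (n + k) k
    have h2 : (((n + k).choose k * (n + k + 1) : ℕ) : ℝ) =
        (((n + k + 1).choose k * (n + 1) : ℕ) : ℝ) := by
      rw [this]; congr 2; omega
    push_cast at h2
    rw [show n + 1 + k = n + k + 1 by ring]
    linarith
  have h3 : (n : ℝ) + 1 ≠ 0 := by positivity
  unfold aperyLam
  rw [← mul_left_inj' h3]
  linear_combination ((n + 1 + k).choose k : ℝ) * (n + 1) * h1 + (n.choose k * (n + 1) : ℝ) * h2

theorem aperyLam_succ_succ (n k : ℕ) :
    aperyLam (n + 1) (k + 1) * ((k : ℝ) + 1) ^ 2 =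
      ((n : ℝ) + k + 2) * ((n : ℝ) + k + 1) * aperyLam n k := by
  have h1 : ((n + 1).choose (k + 1) : ℝ) * ((k : ℝ) + 1) = (n + 1) * n.choose k := by
    exact_mod_cast (Nat.add_one_mul_choose_eq n k).symm
  have h2 : ((n + 1 + (k + 1)).choose (k + 1) : ℝ) * ((k : ℝ) + 1) =
      (n + k + 2) * (n + k + 1).choose k := by
    have := (Nat.add_one_mul_choose_eq (n + k + 1) k).symm
    rw [show n + 1 + (k + 1) = n + k + 1 + 1 by ring]
    have h := congrArg (Nat.cast (R := ℝ)) this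
    push_cast at h
    linear_combination h
  have h3 : ((n + k + 1).choose k : ℝ) * ((n : ℝ) + 1) = (n + k).choose k * (n + k + 1) := by
    have := Nat.choose_mul_succ_eq (n + k) k
    have h2 : (((n + k).choose k * (n + k + 1) : ℕ) : ℝ) =
        (((n + k + 1).choose k * (n + 1) : ℕ) : ℝ) := by
      rw [this]; congr 2; omega
    push_cast at h2
    linarith
  unfold aperyLam
  linear_combination ((n + 1 + (k + 1)).choose (k + 1) : ℝ) * (k + 1) * h1 +
    ((n + 1) * n.choose k : ℝ) * h2 + (n.choose k * (n + k + 2) : ℝ) * h3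

/-- The inner sums in the numerators of Apéry's approximations to `ζ(3)`. -/
noncomputable def aperyC (n k : ℕ) : ℝ :=
  ∑ m ∈ range n, 1 / ((m : ℝ) + 1) ^ 3 +
    ∑ m ∈ range k, (-1) ^ m / (2 * ((m : ℝ) + 1) ^ 3 * aperyLam n (m + 1))

theorem aperyC_succ_right (n k : ℕ) :
    aperyC n (k + 1) =
      aperyC n k + (-1) ^ k / (2 * ((k : ℝ) + 1) ^ 3 * aperyLam n (k + 1)) := by
  rw [aperyC, sum_range_succ _ k, aperyC]; ring

theorem aperyC_zero_right (n : ℕ) : aperyC n 0 = ∑ m ∈ range n, 1 / ((m : ℝ) + 1) ^ 3 := by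
  simp [aperyC]

theorem aperyC_succ_left {n k : ℕ} (h : k ≤ n) :
    aperyC (n + 1) k = aperyC n k +
      (-1) ^ k / (((n : ℝ) + 1) ^ 2 * ((n : ℝ) + 1 - k) * aperyLam (n + 1) k) := by
  induction k with
  | zero =>
    rw [aperyC_zero_right, aperyC_zero_right, sum_range_succ, aperyLam_zero]
    have : (n : ℝ) + 1 ≠ 0 := by positivity
    field_simp
    simp
    ring
  | succ k ih =>
    rw [aperyC_succ_right, aperyC_succ_right, ih (by omega)]
    have e1 := aperyLam_succ_left n (k + 1)
    have e2 := aperyLam_succ_succ n k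
    have e3 := aperyLam_succ_left n k
    have hk : (k : ℝ) + 1 ≤ n := by exact_mod_cast h
    have hk0 : (0 : ℝ) ≤ k := by positivity
    have p0 := aperyLam_pos h
    have p1 := aperyLam_pos (show k + 1 ≤ n + 1 by omega)
    have p2 := aperyLam_pos (show k ≤ n by omega)
    have p3 := aperyLam_pos (show k ≤ n + 1 by omega)
    push_cast at e1 ⊢
    have n1 : (n : ℝ) + 1 - k ≠ 0 := by intro h; linarith
    have n2 : (n : ℝ) - k ≠ 0 := by intro h; linarith
    have n3 : (n : ℝ) + 2 + k ≠ 0 := by positivity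
    have n4 : (n : ℝ) + 1 + k ≠ 0 := by positivity
    have n5 : (k : ℝ) + 1 ≠ 0 := by positivity
    have n6 : (n : ℝ) + 1 ≠ 0 := by positivity
    have n7 : (n : ℝ) + 1 - (k + 1) ≠ 0 := by intro h; linarith
    obtain ⟨x, hx⟩ : ∃ x, x = aperyLam (n + 1) (k + 1) := ⟨_, rfl⟩
    have f1 : aperyLam n (k + 1) = x * (n - k) / (n + 2 + k) := by
      rw [hx]; field_simp; linear_combination -e1
    have f2 : aperyLam (n + 1) k = x * (k + 1) ^ 2 / ((n + 2 + k) * (n + 1 - k)) := by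
      rw [hx]; field_simp
      apply mul_left_cancel₀ n4
      linear_combination (n + 2 + k : ℝ) * (n + 1 + k) * e3 - (n + 1 + k : ℝ) * e2
    rw [← hx] at p1
    have hx0 := p1.ne'
    rw [f1, f2, ← hx]
    field_simp
    ring

/-- The certificate for creative telescoping of Apéry's recurrence. -/
noncomputable def aperyCert (n k : ℕ) (c e : ℝ) : ℝ :=
  4 * (2 * n + 3) * (k * (2 * k + 1) - (2 * n + 3) ^ 2) * aperyLam (n + 1) k ^ 2 * c +
    5 * (2 * n + 3) * (-1) ^ (k + 1) * k / ((n + 1) * (n + 2)) * aperyLam (n + 1) k * e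

/-- The middle coefficient of Apéry's recurrence, shifted by one. -/
noncomputable def aperyP (n : ℕ) : ℝ :=
  34 * ((n : ℝ) + 1) ^ 3 + 51 * ((n : ℝ) + 1) ^ 2 + 27 * ((n : ℝ) + 1) + 5

theorem exists_aperyLam_eq (n k : ℕ) : ∃ μ : ℝ,
    aperyLam n (k + 1) = μ * (n + 1 - k) * (n - k) ∧
    aperyLam (n + 1) (k + 1) = μ * (n + 2 + k) * (n + 1 - k) ∧
    aperyLam (n + 2) (k + 1) = μ * (n + 3 + k) * (n + 2 + k) ∧
    aperyLam (n + 1) k = μ * (k + 1) ^ 2 := by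
  have n3 : (n : ℝ) + 2 + k ≠ 0 := by positivity
  have n4 : (n : ℝ) + 3 + k ≠ 0 := by positivity
  have n5 : (k : ℝ) + 1 ≠ 0 := by positivity
  have e1 := aperyLam_succ_left n (k + 1)
  have e2 := aperyLam_succ_left (n + 1) (k + 1)
  have e3 := aperyLam_succ_succ (n + 1) k
  push_cast at e1 e2 e3
  rw [show n + 1 + 1 = n + 2 by ring] at e2 e3
  have f1 : aperyLam (n + 1) (k + 1) = aperyLam (n + 2) (k + 1) * (n + 1 - k) / (n + 3 + k) := by
    field_simp; linear_combination -e2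
  refine ⟨aperyLam (n + 2) (k + 1) / ((n + 3 + k) * (n + 2 + k)), ?_, ?_, ?_, ?_⟩
  · have : aperyLam n (k + 1) = aperyLam (n + 1) (k + 1) * (n - k) / (n + 2 + k) := by
      field_simp; linear_combination -e1
    rw [this, f1]; field_simp
  · rw [f1]; field_simp
  · field_simp
  · field_simp; linear_combination -e3

theorem aperyCert_zero (n : ℕ) (c : ℝ) :
    ((n : ℝ) + 2) ^ 3 * (c + 1 / (n + 2) ^ 3) - aperyP n * c
      + ((n : ℝ) + 1) ^ 3 * (c - 1 / (n + 1) ^ 3) = aperyCert n 0 c 1 := by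
  have n1 : (n : ℝ) + 1 ≠ 0 := by positivity
  have n2 : (n : ℝ) + 2 ≠ 0 := by positivity
  rw [aperyP, aperyCert, aperyLam_zero]
  field_simp
  push_cast
  ring

theorem apery_telescope (n k : ℕ) :
    ((n : ℝ) + 2) ^ 3 * aperyLam (n + 2) (k + 1) ^ 2 - aperyP n * aperyLam (n + 1) (k + 1) ^ 2
      + ((n : ℝ) + 1) ^ 3 * aperyLam n (k + 1) ^ 2 =
      aperyCert n (k + 1) 1 0 - aperyCert n k 1 0 := by
  obtain ⟨μ, h0, h1, h2, h3⟩ := exists_aperyLam_eq n k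
  rw [aperyCert, aperyCert, h0, h1, h2, h3, aperyP]
  push_cast
  ring

theorem apery_telescope_num {n k : ℕ} (h : k ≤ n) :
    ((n : ℝ) + 2) ^ 3 * (aperyLam (n + 2) (k + 1) ^ 2 * aperyC (n + 2) (k + 1))
      - aperyP n * (aperyLam (n + 1) (k + 1) ^ 2 * aperyC (n + 1) (k + 1))
      + ((n : ℝ) + 1) ^ 3 * (aperyLam n (k + 1) ^ 2 * aperyC n (k + 1)) =
      aperyCert n (k + 1) (aperyC (n + 1) (k + 1)) 1 - aperyCert n k (aperyC (n + 1) k) 1 := by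
  obtain ⟨μ, h0, h1, h2, h3⟩ := exists_aperyLam_eq n k
  have hk : (k : ℝ) ≤ n := by exact_mod_cast h
  have n1 : (n : ℝ) + 1 - k ≠ 0 := by intro h; linarith
  have n3 : (n : ℝ) + 2 + k ≠ 0 := by positivity
  have n4 : (n : ℝ) + 3 + k ≠ 0 := by positivity
  have n5 : (k : ℝ) + 1 ≠ 0 := by positivity
  have n6 : (n : ℝ) + 1 ≠ 0 := by positivity
  have n7 : (n : ℝ) + 2 ≠ 0 := by positivity
  have hμ : μ ≠ 0 := by
    rintro rfl
    have := aperyLam_pos (show k ≤ n + 1 by omega)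
    rw [h3] at this
    simp at this
  have e1 := aperyC_succ_right (n + 1) k
  have e2 := aperyC_succ_left (show k + 1 ≤ n + 1 by omega)
  have e3 : aperyLam n (k + 1) ^ 2 * aperyC n (k + 1) =
      aperyLam n (k + 1) ^ 2 * aperyC (n + 1) (k + 1)
        + (-1) ^ k * aperyLam n (k + 1) / ((n + 1) ^ 2 * (n + 2 + k)) := by
    rcases h.eq_or_lt with rfl | h
    · rw [aperyLam_eq_zero (Nat.lt_succ_self k)]; simp
    · have hk : (k : ℝ) + 1 ≤ n := by exact_mod_cast h
      have n8 : (n : ℝ) - k ≠ 0 := by intro h; linarith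
      have n9 : (n : ℝ) + 1 - (k + 1) ≠ 0 := by intro h; linarith
      rw [aperyC_succ_left (show k + 1 ≤ n by omega), h0, h1]
      push_cast
      field_simp
      ring
  rw [show n + 1 + 1 = n + 2 by ring] at e2
  rw [e3, e2, e1, aperyCert, aperyCert, h0, h1, h2, h3, aperyP]
  push_cast
  have n10 : (n : ℝ) + 1 + 1 ≠ 0 := by positivity
  have n11 : (n : ℝ) + 1 + 1 - (k + 1) ≠ 0 := by intro h; linarith
  field_simp
  ring

theorem apery_telescope_num_last (n : ℕ) :
    ((n : ℝ) + 2) ^ 3 * (aperyLam (n + 2) (n + 2) ^ 2 * aperyC (n + 2) (n + 2)) =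
      - aperyCert n (n + 1) (aperyC (n + 1) (n + 1)) 1 := by
  have h1 := aperyLam_succ_succ (n + 1) (n + 1)
  have h2 := aperyLam_succ_left (n + 1) (n + 1)
  have p := aperyLam_pos (le_refl (n + 1))
  rw [show n + 2 = (n + 1) + 1 by ring, aperyC_succ_right, aperyC_succ_left le_rfl, aperyCert]
  obtain ⟨x, hx⟩ : ∃ x, x = aperyLam (n + 1) (n + 1) := ⟨_, rfl⟩
  rw [← hx] at h1 h2 p ⊢
  push_cast at *
  have n6 : (n : ℝ) + 1 ≠ 0 := by positivity
  have n7 : (n : ℝ) + 2 ≠ 0 := by positivity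
  have n8 : (n : ℝ) + 1 + 1 ≠ 0 := by positivity
  have n9 : 2 * (n : ℝ) + 3 ≠ 0 := by positivity
  have hx0 := p.ne'
  have f1 : aperyLam (n + 1 + 1) (n + 1 + 1) = 2 * (2 * n + 3) * x / (n + 2) := by
    field_simp
    apply mul_left_cancel₀ n7
    linear_combination h1
  have f2 : aperyLam (n + 1 + 1) (n + 1) = (2 * n + 3) * x := by linear_combination h2
  rw [f1, f2, show (n : ℝ) + 1 + 1 - (n + 1) = 1 by ring]
  rw [show (n : ℝ) + 1 + 1 = n + 2 by ring]
  field_simp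
  ring

/-- The denominators of Apéry's approximations to `ζ(3)`. -/
noncomputable def aperyA (n : ℕ) : ℝ := ∑ k ∈ range (n + 1), aperyLam n k ^ 2

/-- The numerators of Apéry's approximations to `ζ(3)`. -/
noncomputable def aperyB (n : ℕ) : ℝ := ∑ k ∈ range (n + 1), aperyLam n k ^ 2 * aperyC n k

theorem aperyA_recurrence (n : ℕ) :
    ((n : ℝ) + 2) ^ 3 * aperyA (n + 2) - aperyP n * aperyA (n + 1)
      + ((n : ℝ) + 1) ^ 3 * aperyA n = 0 := by
  have h1 : aperyA (n + 1) = ∑ k ∈ range (n + 3), aperyLam (n + 1) k ^ 2 := by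
    rw [sum_range_succ, ← aperyA, aperyLam_eq_zero (by omega)]; simp
  have h0 : aperyA n = ∑ k ∈ range (n + 3), aperyLam n k ^ 2 := by
    rw [sum_range_succ, sum_range_succ, ← aperyA, aperyLam_eq_zero (by omega),
      aperyLam_eq_zero (by omega)]; simp
  have h2 : ∀ K, ∑ k ∈ range (K + 1), (((n : ℝ) + 2) ^ 3 * aperyLam (n + 2) k ^ 2
      - aperyP n * aperyLam (n + 1) k ^ 2 + ((n : ℝ) + 1) ^ 3 * aperyLam n k ^ 2) =
      aperyCert n K 1 0 := by
    intro K
    induction K with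
    | zero =>
      simp only [zero_add, sum_range_one, aperyLam_zero, aperyP, aperyCert]
      push_cast; ring
    | succ K ih => rw [sum_range_succ, ih, apery_telescope]; ring
  have h3 := h2 (n + 2)
  rw [aperyCert, aperyLam_eq_zero (show n + 1 < n + 2 by omega), sum_add_distrib, sum_sub_distrib,
    ← mul_sum, ← mul_sum, ← mul_sum, ← h1, ← h0] at h3
  rw [aperyA, h3]; ring

theorem aperyB_recurrence (n : ℕ) :
    ((n : ℝ) + 2) ^ 3 * aperyB (n + 2) - aperyP n * aperyB (n + 1)
      + ((n : ℝ) + 1) ^ 3 * aperyB n = 0 := by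
  have h1 : aperyB (n + 1) = ∑ k ∈ range (n + 2), aperyLam (n + 1) k ^ 2 * aperyC (n + 1) k := rfl
  have h0 : aperyB n = ∑ k ∈ range (n + 2), aperyLam n k ^ 2 * aperyC n k := by
    rw [sum_range_succ, ← aperyB, aperyLam_eq_zero (by omega)]; simp
  have h2 : ∀ K ≤ n + 1, ∑ k ∈ range (K + 1),
      (((n : ℝ) + 2) ^ 3 * (aperyLam (n + 2) k ^ 2 * aperyC (n + 2) k)
      - aperyP n * (aperyLam (n + 1) k ^ 2 * aperyC (n + 1) k)
      + ((n : ℝ) + 1) ^ 3 * (aperyLam n k ^ 2 * aperyC n k)) =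
      aperyCert n K (aperyC (n + 1) K) 1 := by
    intro K hK
    induction K with
    | zero =>
      rw [← aperyCert_zero]
      simp only [zero_add, aperyLam_zero, aperyC_zero_right, sum_range_succ]
      push_cast
      rw [show (n : ℝ) + 1 + 1 = n + 2 by ring]
      ring
    | succ K ih => rw [sum_range_succ, ih (by omega), apery_telescope_num (by omega)]; ring
  have h3 := h2 (n + 1) le_rfl
  rw [sum_add_distrib, sum_sub_distrib, ← mul_sum, ← mul_sum, ← mul_sum, ← h1, ← h0] at h3
  rw [aperyB, sum_range_succ, mul_add, apery_telescope_num_last]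
  linarith

theorem aperyA_pos (n : ℕ) : 0 < aperyA n :=
  sum_pos (fun k hk => by
    have := aperyLam_pos (show k ≤ n by have := mem_range.1 hk; omega)
    positivity) ⟨0, by simp⟩

theorem aperyA_le_succ (n : ℕ) : aperyA n ≤ aperyA (n + 1) := by
  unfold aperyA
  rw [sum_range_succ _ (n + 1)]
  refine le_add_of_le_of_nonneg (sum_le_sum fun k hk => ?_) (by positivity)
  refine pow_le_pow_left₀ (aperyLam_nonneg n k) ?_ 2
  unfold aperyLam
  gcongr
  · omega
  · omega

theorem apery_casoratian (n : ℕ) :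
    aperyB (n + 1) * aperyA n - aperyB n * aperyA (n + 1) = 6 / ((n : ℝ) + 1) ^ 3 := by
  induction n with
  | zero =>
    simp only [aperyA, aperyB, aperyC, aperyLam, sum_range_succ, sum_range_zero]
    norm_num [Nat.choose]
  | succ n ih =>
    have ha := aperyA_recurrence n
    have hb := aperyB_recurrence n
    have n1 : (n : ℝ) + 1 ≠ 0 := by positivity
    have n2 : (n : ℝ) + 2 ≠ 0 := by positivity
    have n3 : (n : ℝ) + 1 + 1 ≠ 0 := by positivity
    rw [eq_div_iff (by positivity)] at ih ⊢
    push_cast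
    rw [show (n : ℝ) + 1 + 1 = n + 2 by ring]
    linear_combination ih + aperyA (n + 1) * hb - aperyB (n + 1) * ha

theorem mul_aperyA_le {n : ℕ} {c : ℝ}
    (h : c * ((n : ℝ) + 2) ^ 3 ≤
      33 * ((n : ℝ) + 1) ^ 3 + 51 * ((n : ℝ) + 1) ^ 2 + 27 * ((n : ℝ) + 1) + 5) :
    c * aperyA (n + 1) ≤ aperyA (n + 2) := by
  have ha := aperyA_recurrence n
  have h1 := aperyA_le_succ n
  have h2 := aperyA_pos (n + 1)
  have h3 : (0 : ℝ) < ((n : ℝ) + 2) ^ 3 := by positivity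
  rw [aperyP] at ha
  have h4 := mul_le_mul_of_nonneg_right h h2.le
  have h5 := mul_le_mul_of_nonneg_left h1 (by positivity : (0 : ℝ) ≤ ((n : ℝ) + 1) ^ 3)
  refine le_of_mul_le_mul_left ?_ h3
  linarith

theorem two_mul_aperyA_le (n : ℕ) : 2 * aperyA n ≤ aperyA (n + 1) := by
  cases n with
  | zero =>
    simp only [aperyA, aperyLam, sum_range_succ, sum_range_zero]
    norm_num [Nat.choose]
  | succ n =>
    apply mul_aperyA_le
    have : (0 : ℝ) ≤ n := by positivity
    nlinarith [pow_nonneg this 2, pow_nonneg this 3]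

theorem exists_le_aperyA : ∃ c : ℝ, 0 < c ∧ ∀ n ≥ 31, c * 31 ^ n ≤ aperyA n := by
  refine ⟨aperyA 31 / 31 ^ 31, by have := aperyA_pos 31; positivity, fun n hn => ?_⟩
  induction n, hn using Nat.le_induction with
  | base => field_simp; exact le_rfl
  | succ n hn ih =>
    obtain ⟨m, rfl⟩ : ∃ m, n = m + 1 := ⟨n - 1, by omega⟩
    have h1 := mul_aperyA_le (n := m) (c := 31) (by
      have : (30 : ℝ) ≤ m := by
        have : 30 ≤ m := by omega
        exact_mod_cast this
      obtain ⟨x, hx⟩ : ∃ x : ℝ, x = m - 30 := ⟨_, rfl⟩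
      have hx0 : 0 ≤ x := by linarith
      rw [show (m : ℝ) = x + 30 by linarith]
      nlinarith [pow_nonneg hx0 2, pow_nonneg hx0 3])
    calc aperyA 31 / 31 ^ 31 * 31 ^ (m + 1 + 1)
        = 31 * (aperyA 31 / 31 ^ 31 * 31 ^ (m + 1)) := by ring
      _ ≤ 31 * aperyA (m + 1) := by linarith
      _ ≤ _ := h1

theorem hasSum_zetaVal {i : ℕ} (hi : 2 ≤ i) :
    HasSum (fun m : ℕ => 1 / ((m : ℝ) + 1) ^ i) (zetaVal i) := by
  have h := (summable_nat_add_iff 1).2 (Real.summable_one_div_nat_pow.2 (show 1 < i by omega))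
  push_cast at h
  exact h.hasSum

theorem sum_range_le_zetaVal {i : ℕ} (hi : 2 ≤ i) (k : ℕ) :
    ∑ m ∈ range k, 1 / ((m : ℝ) + 1) ^ i ≤ zetaVal i :=
  sum_le_hasSum _ (fun _ _ => by positivity) (hasSum_zetaVal hi)

theorem add_one_le_aperyLam {n k : ℕ} (h : k < n) : (n : ℝ) + 1 ≤ aperyLam n (k + 1) := by
  have h1 : 1 ≤ n.choose (k + 1) := Nat.choose_pos (by omega)
  have h2 : n + 1 ≤ (n + (k + 1)).choose (k + 1) := by
    rw [← Nat.choose_symm_add]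
    calc n + 1 = (n + 1).choose n := by simp
      _ ≤ _ := Nat.choose_le_choose _ (by omega)
  have h3 : (1 : ℝ) ≤ n.choose (k + 1) := by exact_mod_cast h1
  have h4 : (n : ℝ) + 1 ≤ ((n + (k + 1)).choose (k + 1) : ℕ) := by exact_mod_cast h2
  unfold aperyLam
  nlinarith

theorem abs_aperyC_sub_le {n k : ℕ} (h : k ≤ n) :
    |aperyC n k - ∑ m ∈ range n, 1 / ((m : ℝ) + 1) ^ 3| ≤ zetaVal 3 / (n + 1) := by
  rw [aperyC, add_sub_cancel_left]
  refine (abs_sum_le_sum_abs _ _).trans ?_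
  rw [le_div_iff₀ (by positivity), sum_mul]
  refine le_trans (sum_le_sum fun m hm => ?_) (sum_range_le_zetaVal (i := 3) (by norm_num) k)
  have hm' := add_one_le_aperyLam (show m < n by have := mem_range.1 hm; omega)
  have hn : (0 : ℝ) < n + 1 := by positivity
  have hl : 0 < aperyLam n (m + 1) := by linarith
  rw [abs_div, abs_pow, abs_neg, abs_one, one_pow, abs_of_pos (by positivity), div_mul_eq_mul_div,
    div_le_div_iff₀ (by positivity) (by positivity)]
  have : (0 : ℝ) < ((m : ℝ) + 1) ^ 3 := by positivity
  nlinarith [mul_le_mul_of_nonneg_left hm' this.le, mul_pos this hl]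

theorem tendsto_aperyB_div_aperyA :
    Tendsto (fun n => aperyB n / aperyA n) atTop (𝓝 (zetaVal 3)) := by
  have h1 := (hasSum_zetaVal (i := 3) (by norm_num)).tendsto_sum_nat
  have h2 : Tendsto (fun n : ℕ => zetaVal 3 / ((n : ℝ) + 1)) atTop (𝓝 0) :=
    tendsto_const_nhds.div_atTop
      (tendsto_atTop_add_const_right _ _ tendsto_natCast_atTop_atTop)
  have h3 : Tendsto (fun n => aperyB n / aperyA n - ∑ m ∈ range n, 1 / ((m : ℝ) + 1) ^ 3)
      atTop (𝓝 0) := by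
    refine squeeze_zero_norm (fun n => ?_) h2
    have ha := aperyA_pos n
    rw [Real.norm_eq_abs, div_sub' ha.ne', abs_div, abs_of_pos ha, div_le_iff₀ ha,
      aperyB, aperyA, sum_mul, mul_sum, ← sum_sub_distrib]
    refine (abs_sum_le_sum_abs _ _).trans (sum_le_sum fun k hk => ?_)
    rw [← mul_sub, abs_mul, abs_of_nonneg (sq_nonneg _), mul_comm]
    exact mul_le_mul_of_nonneg_right
      (abs_aperyC_sub_le (by have := mem_range.1 hk; omega)) (sq_nonneg _)
  simpa using h3.add h1

theorem apery_linear_form_bounds (n : ℕ) :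
    0 < aperyA n * zetaVal 3 - aperyB n ∧
      aperyA n * zetaVal 3 - aperyB n ≤ 7 / aperyA n := by
  have hpos := aperyA_pos
  have hx : ∀ n, aperyB n / aperyA n < aperyB (n + 1) / aperyA (n + 1) := by
    intro n
    rw [div_lt_div_iff₀ (hpos _) (hpos _)]
    have h1 := apery_casoratian n
    have h2 : (0 : ℝ) < 6 / ((n : ℝ) + 1) ^ 3 := by positivity
    linarith
  have hy : Antitone fun n => aperyB n / aperyA n + 7 / aperyA n ^ 2 := by
    refine antitone_nat_of_succ_le fun n => ?_
    have h1 := apery_casoratian n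
    have h2 : 6 / ((n : ℝ) + 1) ^ 3 ≤ 6 := by
      apply div_le_self (by norm_num)
      apply one_le_pow₀
      have : (0 : ℝ) ≤ n := by positivity
      linarith
    have h3 := two_mul_aperyA_le n
    have p := hpos n
    have p' := hpos (n + 1)
    have e : aperyB (n + 1) / aperyA (n + 1) - aperyB n / aperyA n =
        (6 / ((n : ℝ) + 1) ^ 3) / (aperyA n * aperyA (n + 1)) := by
      rw [← h1]; field_simp
    have h4 : (6 / ((n : ℝ) + 1) ^ 3) / (aperyA n * aperyA (n + 1)) ≤
        7 / aperyA n ^ 2 - 7 / aperyA (n + 1) ^ 2 := by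
      refine (div_le_div_of_nonneg_right h2 (by positivity)).trans ?_
      rw [div_sub_div _ _ (by positivity) (by positivity),
        div_le_div_iff₀ (by positivity) (by positivity)]
      have h5 : 6 * (aperyA n * aperyA (n + 1)) ≤
          7 * aperyA (n + 1) ^ 2 - aperyA n ^ 2 * 7 := by nlinarith
      have := mul_le_mul_of_nonneg_right h5 (mul_pos p p').le
      nlinarith
    linarith
  have hmono : Monotone fun n => aperyB n / aperyA n := monotone_nat_of_le_succ fun n => (hx n).le
  have hlim := tendsto_aperyB_div_aperyA
  have p := hpos n
  constructor
  · have h1 := hmono.ge_of_tendsto hlim (n + 1)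
    have h2 := (hx n).trans_le h1
    rw [div_lt_iff₀ p] at h2
    linarith
  · have h1 : zetaVal 3 ≤ aperyB n / aperyA n + 7 / aperyA n ^ 2 := by
      refine le_of_tendsto hlim (eventually_atTop.2 ⟨n, fun m hm => ?_⟩)
      have h2 := hy hm
      have h3 : 0 ≤ 7 / aperyA m ^ 2 := by positivity
      simp only at h2
      linarith
    have h2 := mul_le_mul_of_nonneg_left h1 p.le
    have e : aperyA n * (aperyB n / aperyA n + 7 / aperyA n ^ 2) = aperyB n + 7 / aperyA n := by
      field_simp
    linarith

theorem exists_int_eq_div_of_le {n m d : ℕ} (hm : 0 < m) (hmn : m ≤ n)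
    (hd : ∀ j, 0 < j → j ≤ n → j ∣ d) : ∃ z : ℤ, (d : ℝ) / m = z := by
  obtain ⟨c, rfl⟩ := hd m hm hmn
  refine ⟨c, ?_⟩
  have : (m : ℝ) ≠ 0 := by positivity
  push_cast
  field_simp

theorem exists_int_eq_div_mul_choose {n m d : ℕ} (hm : 0 < m) (hmn : m ≤ n)
    (hd : ∀ j, 0 < j → j ≤ n → j ∣ d) : ∃ z : ℤ, (d : ℝ) / (m * n.choose m) = z := by
  induction m, hm using Nat.le_induction generalizing n with
  | base => simpa using exists_int_eq_div_of_le (m := n) (by omega) le_rfl hd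
  | succ m hm ih =>
    obtain ⟨n, rfl⟩ : ∃ k, n = k + 1 := ⟨n - 1, by omega⟩
    obtain ⟨z1, h1⟩ := ih (n := n) (by omega) fun j h0 h1 => hd j h0 (by omega)
    obtain ⟨z2, h2⟩ := ih (n := n + 1) (by omega) hd
    refine ⟨z1 - z2, ?_⟩
    push_cast
    rw [← h1, ← h2]
    have e1 : ((n + 1).choose (m + 1) : ℝ) * ((m : ℝ) + 1) = (n + 1) * n.choose m := by
      exact_mod_cast (Nat.add_one_mul_choose_eq n m).symm
    have e2 : ((n + 1).choose m : ℝ) * ((n : ℝ) + 1 - m) = n.choose m * (n + 1) := by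
      have := Nat.choose_mul_succ_eq n m
      have h2 : ((n.choose m * (n + 1) : ℕ) : ℝ) = (((n + 1).choose m * (n + 1 - m) : ℕ) : ℝ) := by
        exact_mod_cast this
      push_cast [Nat.cast_sub (show m ≤ n + 1 by omega)] at h2
      linarith
    have hm' : (m : ℝ) + 1 ≤ n + 1 := by exact_mod_cast hmn
    have n1 : (n : ℝ) + 1 - m ≠ 0 := by intro h; linarith
    have n2 : (m : ℝ) + 1 ≠ 0 := by positivity
    have n3 : (m : ℝ) ≠ 0 := by positivity
    have n4 : (n : ℝ) + 1 ≠ 0 := by positivity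
    have n5 : (n.choose m : ℝ) ≠ 0 := by
      have : 0 < n.choose m := Nat.choose_pos (by omega)
      positivity
    have f1 : ((n + 1).choose (m + 1) : ℝ) = (n + 1) * n.choose m / (m + 1) := by
      field_simp; linear_combination e1
    have f2 : ((n + 1).choose m : ℝ) = n.choose m * (n + 1) / (n + 1 - m) := by
      field_simp; linear_combination e2
    rw [f1, f2]
    field_simp
    ring

theorem exists_int_eq_mul_aperyC {n k d : ℕ} (hk : k ≤ n)
    (hd : ∀ j, 0 < j → j ≤ n → j ∣ d) :
    ∃ z : ℤ, 2 * (d : ℝ) ^ 3 * (aperyLam n k ^ 2 * aperyC n k) = z := by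
  have hL : ∃ z : ℤ, aperyLam n k = z := ⟨n.choose k * (n + k).choose k, by simp [aperyLam]⟩
  obtain ⟨L, hL⟩ := hL
  have h1 : ∀ m ∈ range n, ∃ z : ℤ, (d : ℝ) ^ 3 * (1 / ((m : ℝ) + 1) ^ 3) = z := by
    intro m hm
    obtain ⟨z, hz⟩ := exists_int_eq_div_of_le (m := m + 1) (by omega) (mem_range.1 hm) hd
    refine ⟨z ^ 3, ?_⟩
    push_cast at hz ⊢
    rw [← hz]
    field_simp
  have h2 : ∀ m ∈ range k, ∃ z : ℤ, 2 * (d : ℝ) ^ 3 * aperyLam n k *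
      ((-1) ^ m / (2 * ((m : ℝ) + 1) ^ 3 * aperyLam n (m + 1))) = z := by
    intro m hm
    have hm := mem_range.1 hm
    obtain ⟨z1, hz1⟩ := exists_int_eq_div_of_le (m := m + 1) (by omega) (by omega) hd
    obtain ⟨z2, hz2⟩ := exists_int_eq_div_mul_choose (m := m + 1) (n := n) (by omega) (by omega) hd
    obtain ⟨z3, hz3⟩ := exists_int_eq_div_mul_choose (m := m + 1) (n := k) (by omega) (by omega)
      fun j h0 h1 => hd j h0 (by omega)
    have e : ((n + k).choose k : ℝ) * k.choose (m + 1) =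
        (n + (m + 1)).choose (m + 1) * (n + k).choose (k - (m + 1)) := by
      have h := Nat.choose_mul (n := n + k) (k := k) (s := m + 1) (by omega)
      have h' := Nat.choose_mul (n := n + k) (k := n + (m + 1)) (s := m + 1) (by omega)
      have e1 : (n + k).choose (k - (m + 1)) = (n + k).choose (n + (m + 1)) := by
        rw [← Nat.choose_symm (show k - (m + 1) ≤ n + k by omega)]
        congr 1; omega
      have e2 : (n + k - (m + 1)).choose (k - (m + 1)) =
          (n + k - (m + 1)).choose (n + (m + 1) - (m + 1)) := by
        rw [← Nat.choose_symm (show k - (m + 1) ≤ n + k - (m + 1) by omega)]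
        congr 1; omega
      have : (n + k).choose k * k.choose (m + 1) =
          (n + (m + 1)).choose (m + 1) * (n + k).choose (k - (m + 1)) := by
        rw [e1, h, e2, mul_comm ((n + (m + 1)).choose (m + 1)), h']
      exact_mod_cast this
    refine ⟨(-1) ^ m * n.choose k * (n + k).choose (k - (m + 1)) * z1 * z2 * z3, ?_⟩
    push_cast at hz1 hz2 hz3 ⊢
    rw [← hz1, ← hz2, ← hz3, aperyLam, aperyLam]
    have c1 : ((n.choose (m + 1) : ℕ) : ℝ) ≠ 0 := by
      have : 0 < n.choose (m + 1) := Nat.choose_pos (by omega)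
      positivity
    have c2 : ((k.choose (m + 1) : ℕ) : ℝ) ≠ 0 := by
      have : 0 < k.choose (m + 1) := Nat.choose_pos (by omega)
      positivity
    have c3 : (((n + (m + 1)).choose (m + 1) : ℕ) : ℝ) ≠ 0 := by
      have : 0 < (n + (m + 1)).choose (m + 1) := Nat.choose_pos (by omega)
      positivity
    have n1 : (m : ℝ) + 1 ≠ 0 := by positivity
    field_simp
    linear_combination ((d : ℝ) ^ 3 * n.choose k) * e
  choose! f hf using h1
  choose! g hg using h2
  refine ⟨2 * L ^ 2 * ∑ m ∈ range n, f m + L * ∑ m ∈ range k, g m, ?_⟩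
  push_cast
  rw [← sum_congr rfl hf, ← sum_congr rfl hg, ← mul_sum, ← mul_sum, ← hL, aperyC]
  ring

theorem irrational_zetaVal_three : Irrational (zetaVal 3) := by
  rintro ⟨r, hr⟩
  obtain ⟨K, hK, hlcm⟩ := exists_lcmUpto_le
  obtain ⟨c, hc, hA⟩ := exists_le_aperyA
  have h_int : ∀ n, ∃ z : ℤ, 2 * (r.den : ℝ) * (Nat.lcmUpto n : ℝ) ^ 3 *
      (aperyA n * zetaVal 3 - aperyB n) = z := by
    intro n
    have hd : ∀ j, 0 < j → j ≤ n → j ∣ Nat.lcmUpto n := fun j h0 h1 =>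
      dvd_lcm (f := id) (mem_Icc.2 ⟨h0, h1⟩)
    have h1 : ∀ k ∈ range (n + 1), ∃ z : ℤ,
        2 * (Nat.lcmUpto n : ℝ) ^ 3 * (aperyLam n k ^ 2 * aperyC n k) = z := fun k hk =>
      exists_int_eq_mul_aperyC (by have := mem_range.1 hk; omega) hd
    choose! f hf using h1
    have h2 : aperyA n = ((∑ k ∈ range (n + 1), ((n.choose k *
        (n + k).choose k) ^ 2 : ℤ) : ℤ) : ℝ) := by
      simp [aperyA, aperyLam]
    refine ⟨2 * Nat.lcmUpto n ^ 3 * (∑ k ∈ range (n + 1), ((n.choose k * (n + k).choose k) ^ 2 : ℤ))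
      * r.num - r.den * ∑ k ∈ range (n + 1), f k, ?_⟩
    have h3 : (r.den : ℝ) * zetaVal 3 = r.num := by
      rw [← hr]
      exact_mod_cast Rat.den_mul_eq_num r
    have h4 : ((∑ k ∈ range (n + 1), f k : ℤ) : ℝ) = 2 * (Nat.lcmUpto n : ℝ) ^ 3 * aperyB n := by
      rw [Int.cast_sum, ← sum_congr rfl hf, ← mul_sum, ← aperyB]
    rw [Int.cast_sub, Int.cast_mul, Int.cast_mul (_ * _), ← h2, Int.cast_mul,
        Int.cast_mul (r.den : ℤ), h4]
    push_cast
    linear_combination 2 * (Nat.lcmUpto n : ℝ) ^ 3 * aperyA n * h3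
  have hlim : Tendsto (fun n : ℕ => 2 * (r.den : ℝ) * K ^ 3 * 7 / c * (29.791 / 31 : ℝ) ^ n)
      atTop (𝓝 0) := by
    simpa using (tendsto_pow_atTop_nhds_zero_of_lt_one (r := (29.791 / 31 : ℝ))
      (by norm_num) (by norm_num)).const_mul (2 * (r.den : ℝ) * K ^ 3 * 7 / c)
  obtain ⟨n, hn31, hn⟩ := ((eventually_ge_atTop 31).and
    (hlim.eventually (gt_mem_nhds one_pos))).exists
  obtain ⟨z, hz⟩ := h_int n
  obtain ⟨hpos, hle⟩ := apery_linear_form_bounds n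
  have hl0 : (0 : ℝ) < Nat.lcmUpto n := by exact_mod_cast Nat.lcmUpto_pos n
  have hden : (0 : ℝ) < r.den := by exact_mod_cast r.den_pos
  have hz0 : (0 : ℝ) < z := by rw [← hz]; positivity
  have hz1 : (1 : ℝ) ≤ z := by
    have : 0 < z := by exact_mod_cast hz0
    exact_mod_cast this
  have hA' := hA n hn31
  have h4 : (Nat.lcmUpto n : ℝ) ^ 3 ≤ K ^ 3 * 29.791 ^ n := by
    refine (pow_le_pow_left₀ hl0.le (hlcm n) 3).trans (le_of_eq ?_)
    rw [mul_pow, ← pow_mul, mul_comm n 3, pow_mul]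
    norm_num
  have h5 : aperyA n * zetaVal 3 - aperyB n ≤ 7 / (c * 31 ^ n) :=
    hle.trans (div_le_div_of_nonneg_left (by norm_num) (by positivity) hA')
  have h6 : 2 * (r.den : ℝ) * (Nat.lcmUpto n : ℝ) ^ 3 * (aperyA n * zetaVal 3 - aperyB n) ≤
      2 * (r.den : ℝ) * (K ^ 3 * 29.791 ^ n) * (7 / (c * 31 ^ n)) := by
    gcongr
  have h7 : 2 * (r.den : ℝ) * (K ^ 3 * 29.791 ^ n) * (7 / (c * 31 ^ n)) =
      2 * (r.den : ℝ) * K ^ 3 * 7 / c * (29.791 / 31 : ℝ) ^ n := by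
    rw [div_pow]; field_simp
  rw [hz, h7] at h6
  linarith

/-- The real numbers at which none of `t, t + 1, …, t + n` vanishes. -/
abbrev PoleFree (n : ℕ) : Type := {t : ℝ // ∀ k ≤ n, t + k ≠ 0}

/-- The integral combinations of the functions `t ↦ 1 / (d ^ (m - i) * (t + k) ^ i)`
for `1 ≤ i ≤ m` and `0 ≤ k ≤ n`. -/
noncomputable def partialFractions (n d m : ℕ) : Submodule ℤ (PoleFree n → ℝ) :=
  Submodule.span ℤ (Set.range fun (p : Fin m × Fin (n + 1)) (t : PoleFree n) =>
    ((d : ℝ) ^ (m - 1 - p.1))⁻¹ * ((t.1 + p.2) ^ (p.1 + 1 : ℕ))⁻¹)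

theorem mem_partialFractions_generator {n d m i k : ℕ} (hi : i < m) (hk : k ≤ n) :
    (fun t : PoleFree n => ((d : ℝ) ^ (m - 1 - i))⁻¹ * ((t.1 + k) ^ (i + 1))⁻¹) ∈
      partialFractions n d m :=
  Submodule.subset_span ⟨(⟨i, hi⟩, ⟨k, by omega⟩), rfl⟩

theorem mul_inv_mem_partialFractions {n d m i k l : ℕ} (hd0 : d ≠ 0)
    (hd : ∀ j, 0 < j → j ≤ n → j ∣ d) (him : i ≤ m) (hk : k ≤ n) (hl : l ≤ n) :
    (fun t : PoleFree n => ((d : ℝ) ^ (m - i))⁻¹ * ((t.1 + k) ^ i)⁻¹ * (t.1 + l)⁻¹) ∈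
      partialFractions n d (m + 1) := by
  have hd0' : (d : ℝ) ≠ 0 := by exact_mod_cast hd0
  obtain rfl | hkl := eq_or_ne k l
  · have := mem_partialFractions_generator (d := d) (show i < m + 1 by omega) hk
    convert this using 2 with t
    rw [pow_succ, mul_inv, Nat.add_sub_cancel, mul_assoc]
  obtain ⟨c, hc⟩ : ∃ c : ℤ, (d : ℝ) = c * ((l : ℝ) - k) := by
    rcases lt_or_gt_of_ne hkl with h | h
    · obtain ⟨c, hc⟩ := hd (l - k) (by omega) (by omega)
      refine ⟨c, ?_⟩
      rw [hc]
      push_cast [Nat.cast_sub h.le]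
      ring
    · obtain ⟨c, hc⟩ := hd (k - l) (by omega) (by omega)
      refine ⟨-c, ?_⟩
      rw [hc]
      push_cast [Nat.cast_sub h.le]
      ring
  have hlk : (l : ℝ) - k ≠ 0 := by
    intro h
    rw [h, mul_zero] at hc
    exact hd0' hc
  induction i with
  | zero =>
    have := mem_partialFractions_generator (d := d) (show 0 < m + 1 by omega) hl
    simpa using this
  | succ i ih =>
    have h1 := ih (by omega)
    have h2 := mem_partialFractions_generator (d := d) (show i < m + 1 by omega) hk
    have h3 := (partialFractions n d (m + 1)).smul_mem c (Submodule.sub_mem _ h2 h1)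
    convert h3 using 1
    funext t
    have e : (d : ℝ) ^ (m - i) = d ^ (m - (i + 1)) * (c * ((l : ℝ) - k)) := by
      rw [← hc, ← pow_succ]
      congr 1
      omega
    have n1 := t.2 k hk
    have n2 := t.2 l hl
    have n3 : (c : ℝ) ≠ 0 := by
      rintro h
      rw [h, zero_mul] at hc
      exact hd0' hc
    simp only [Pi.smul_apply, Pi.sub_apply, zsmul_eq_mul, Nat.add_sub_cancel, e]
    field_simp
    ring

theorem partialFractions_mul_le {n d m : ℕ} (hd0 : d ≠ 0)
    (hd : ∀ j, 0 < j → j ≤ n → j ∣ d) :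
    partialFractions n d m * partialFractions n d 1 ≤ partialFractions n d (m + 1) := by
  rw [partialFractions, partialFractions, Submodule.span_mul_span, Submodule.span_le]
  rintro _ ⟨_, ⟨⟨i, k⟩, rfl⟩, _, ⟨⟨i', l⟩, rfl⟩, rfl⟩
  have := mul_inv_mem_partialFractions (m := m) (i := i + 1) (k := k) (l := l) hd0 hd
    (by omega) (by omega) (by omega)
  refine (congrArg (· ∈ partialFractions n d (m + 1)) (funext fun t => ?_)).mp this
  have e : m - 1 - (i : ℕ) = m - (i + 1) := by omega
  simp [e]

theorem partialFractions_one_pow_le {n d : ℕ} (hd0 : d ≠ 0)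
    (hd : ∀ j, 0 < j → j ≤ n → j ∣ d) (m : ℕ) :
    partialFractions n d 1 ^ (m + 1) ≤ partialFractions n d (m + 1) := by
  induction m with
  | zero => simp
  | succ m ih =>
    rw [pow_succ]
    exact (mul_le_mul' ih le_rfl).trans (partialFractions_mul_le hd0 hd)

theorem exists_int_factorial_mul_nodalWeight {n k : ℕ} (hk : k ≤ n) :
    ∃ z : ℤ, (n.factorial : ℝ) *
      Lagrange.nodalWeight (range (n + 1)) (fun j : ℕ => -(j : ℝ)) k = z := by
  have e : ∏ j ∈ (range (n + 1)).erase k, (-(k : ℝ) - -(j : ℝ)) =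
      (-1) ^ k * (k.factorial * (n - k).factorial) := by
    obtain ⟨m, rfl⟩ := Nat.exists_eq_add_of_le hk
    have h1 : (range (k + m + 1)).erase k = range k ∪ (range m).map (addLeftEmbedding (k + 1)) := by
      ext x
      simp only [mem_erase, mem_range, mem_union, Finset.mem_map, addLeftEmbedding_apply]
      constructor
      · rintro ⟨h1, h2⟩
        by_cases h : x < k
        · exact Or.inl h
        · exact Or.inr ⟨x - (k + 1), by omega, by omega⟩
      · rintro (h | ⟨a, h1, rfl⟩) <;> omega
    have h2 : Disjoint (range k) ((range m).map (addLeftEmbedding (k + 1))) := by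
      rw [disjoint_left]
      intro a ha hb
      simp only [Finset.mem_map, mem_range, addLeftEmbedding_apply] at ha hb
      obtain ⟨b, -, hb⟩ := hb
      omega
    rw [h1, prod_union h2, prod_map, Nat.add_sub_cancel_left,
      ← prod_range_add_one_eq_factorial, ← prod_range_add_one_eq_factorial,
      ← prod_range_reflect (fun i => i + 1) k, ← mul_assoc]
    congr 1
    · push_cast
      rw [← card_range k, ← prod_const, card_range, ← prod_mul_distrib]
      refine prod_congr rfl fun j hj => ?_
      have : ((k - 1 - j : ℕ) : ℝ) = k - 1 - j := by
        have := mem_range.1 hj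
        rw [Nat.cast_sub (by omega), Nat.cast_sub (by omega)]
        simp
      rw [this]
      ring
    · push_cast
      refine prod_congr rfl fun j hj => ?_
      simp only [addLeftEmbedding_apply]
      push_cast
      ring
  refine ⟨(-1) ^ k * n.choose k, ?_⟩
  rw [Lagrange.nodalWeight, prod_inv_distrib, e]
  have h := Nat.choose_mul_factorial_mul_factorial hk
  have h' : (n.choose k : ℝ) * k.factorial * (n - k).factorial = n.factorial := by
    exact_mod_cast h
  have : ((-1 : ℝ) ^ k) * (-1) ^ k = 1 := by rw [← mul_pow]; simp
  have n1 : (k.factorial : ℝ) ≠ 0 := by positivity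
  have n2 : ((n - k).factorial : ℝ) ≠ 0 := by positivity
  have n3 : (-1 : ℝ) ^ k ≠ 0 := pow_ne_zero _ (by norm_num)
  push_cast
  rw [← h']
  field_simp
  linear_combination (-(n.choose k : ℝ)) * this

theorem div_prod_mem_partialFractions {n d : ℕ} (P : Polynomial ℝ) (hP : P.natDegree ≤ n)
    (h_int : ∀ k ≤ n, ∃ z : ℤ, P.eval (-(k : ℝ)) = n.factorial * z) :
    (fun t : PoleFree n => P.eval t.1 / ∏ j ∈ range (n + 1), (t.1 + j)) ∈
      partialFractions n d 1 := by
  have hw : ∀ k ∈ range (n + 1), ∃ z : ℤ,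
      Lagrange.nodalWeight (range (n + 1)) (fun j : ℕ => -(j : ℝ)) k * P.eval (-(k : ℝ)) = z := by
    intro k hk
    have hk : k ≤ n := by have := mem_range.1 hk; omega
    obtain ⟨z1, h1⟩ := exists_int_factorial_mul_nodalWeight hk
    obtain ⟨z2, h2⟩ := h_int k hk
    refine ⟨z1 * z2, ?_⟩
    push_cast
    rw [h2, ← h1]
    ring
  choose! z hz using hw
  have key : (fun t : PoleFree n => P.eval t.1 / ∏ j ∈ range (n + 1), (t.1 + j)) =
      ∑ k ∈ range (n + 1), z k • fun t : PoleFree n =>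
        ((d : ℝ) ^ (1 - 1 - 0))⁻¹ * ((t.1 + k) ^ (0 + 1))⁻¹ := by
    funext t
    have hinj : Set.InjOn (fun j : ℕ => -(j : ℝ)) (range (n + 1)) := by
      intro a _ b _ h
      simpa using h
    have hdeg : P.degree < #(range (n + 1)) := by
      rw [card_range]
      exact (Polynomial.degree_le_of_natDegree_le hP).trans_lt
          (by exact_mod_cast Nat.lt_succ_self n)
    have h1 := congrArg (Polynomial.eval t.1) (Lagrange.eq_interpolate hinj hdeg)
    rw [Lagrange.eval_interpolate_not_at_node, Lagrange.eval_nodal] at h1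
    · simp only [sub_neg_eq_add] at h1
      have h0 : ∏ j ∈ range (n + 1), (t.1 + j) ≠ 0 :=
        prod_ne_zero_iff.2 fun j hj => t.2 j (by have := mem_range.1 hj; omega)
      rw [h1, mul_div_cancel_left₀ _ h0, Finset.sum_apply]
      refine sum_congr rfl fun k hk => ?_
      rw [Pi.smul_apply, zsmul_eq_mul, ← hz k hk]
      simp
      ring
    · intro i hi h
      exact t.2 i (by have := mem_range.1 hi; omega) (by rw [h]; ring)
  rw [key]
  exact Submodule.sum_mem _ fun k hk => Submodule.smul_mem _ _
    (mem_partialFractions_generator zero_lt_one (by have := mem_range.1 hk; omega))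

/-- The rational function of Fischler, Sprang and Zudilin. -/
noncomputable def fszR (n D s : ℕ) (t : ℝ) : ℝ :=
  (∏ j ∈ range (3 * D * n + 1), ((D : ℝ) * (t - n) + j)) * (n.factorial : ℝ) ^ (s + 1 - 3 * D) /
    (D * (∏ j ∈ range (n + 1), (t + j)) ^ (s + 1))

theorem prod_range_mul_eq {M : Type*} [CommMonoid M] (f : ℕ → M) (N n : ℕ) :
    ∏ x ∈ range (N * n), f x = ∏ b ∈ range N, ∏ j ∈ range n, f (b * n + j) := by
  induction N with
  | zero => simp
  | succ N ih => rw [add_mul, one_mul, prod_range_add, ih, prod_range_succ]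

theorem prod_range_mem_pow {A : Type*} [CommRing A] (M : Submodule ℤ A) (f : ℕ → A)
    (hf : ∀ b, f b ∈ M) (N : ℕ) : ∏ b ∈ range N, f b ∈ M ^ N := by
  induction N with
  | zero => simpa using Submodule.one_le.1 (le_refl (1 : Submodule ℤ A))
  | succ N ih =>
    rw [prod_range_succ, pow_succ]
    exact Submodule.mul_mem_mul ih (hf N)

theorem fszR_mem_partialFractions {n d D s : ℕ} (hn : 0 < n) (hD : 0 < D) (hs : 3 * D ≤ s)
    (hd0 : d ≠ 0) (hd : ∀ j, 0 < j → j ≤ n → j ∣ d) :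
    (fun t : PoleFree n => fszR n D s t.1) ∈ partialFractions n d (s + 1) := by
  refine partialFractions_one_pow_le hd0 hd s ?_
  set A : ℕ → Polynomial ℝ := fun b => ∏ j ∈ range n,
    (Polynomial.C (D : ℝ) * Polynomial.X + Polynomial.C (-(D * n : ℝ) + (b * n + j))) with hA
  have hA1 : ∀ b, (fun t : PoleFree n => (A b).eval t.1 / ∏ j ∈ range (n + 1), (t.1 + j)) ∈
      partialFractions n d 1 := by
    refine fun b => div_prod_mem_partialFractions _ ?_ fun k hk => ?_
    · refine (Polynomial.natDegree_prod_le _ _).trans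
        ((sum_le_card_nsmul _ _ 1 fun j _ => ?_).trans ?_)
      · exact Polynomial.natDegree_linear_le
      · simp
    · obtain ⟨z, hz⟩ := Nat.factorial_coe_dvd_prod n (-(D * k : ℤ) - D * n + b * n)
      refine ⟨z, ?_⟩
      have hz' : ((∏ i ∈ range n, (-(D * k : ℤ) - D * n + b * n + i) : ℤ) : ℝ) =
          n.factorial * z := by rw [hz]; push_cast; rfl
      rw [← hz', hA, Polynomial.eval_prod]
      push_cast
      refine prod_congr rfl fun j _ => ?_
      simp
      ring
  have hB : (fun t : PoleFree n => (Polynomial.C (n.factorial : ℝ)).eval t.1 /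
      ∏ j ∈ range (n + 1), (t.1 + j)) ∈ partialFractions n d 1 :=
    div_prod_mem_partialFractions _ (by simp) fun k _ => ⟨1, by simp⟩
  have hB' : (fun t : PoleFree n => (Polynomial.C (n.factorial : ℝ) * Polynomial.X +
      Polynomial.C (n.factorial * (2 * n) : ℝ)).eval t.1 /
      ∏ j ∈ range (n + 1), (t.1 + j)) ∈ partialFractions n d 1 :=
    div_prod_mem_partialFractions _ (Polynomial.natDegree_linear_le.trans hn)
      fun k _ => ⟨2 * n - k, by simp; ring⟩
  have hD' : (D : ℝ) ≠ 0 := by positivity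
  have h := Submodule.mul_mem_mul (prod_range_mem_pow _ _ hA1 (3 * D))
    (Submodule.mul_mem_mul hB' (prod_range_mem_pow _ _ (fun _ => hB) (s - 3 * D)))
  rw [← pow_succ', ← pow_add, show 3 * D + (s - 3 * D + 1) = s + 1 by omega] at h
  refine (congrArg (· ∈ partialFractions n d 1 ^ (s + 1)) (funext fun t => ?_)).mp h
  obtain ⟨m, rfl⟩ := Nat.exists_eq_add_of_le hs
  have h0 : ∏ j ∈ range (n + 1), (t.1 + j) ≠ 0 :=
    prod_ne_zero_iff.2 fun j hj => t.2 j (by have := mem_range.1 hj; omega)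
  simp only [Pi.mul_apply, Finset.prod_apply, prod_div_distrib, prod_const, card_range,
      Pi.pow_apply]
  rw [fszR, show 3 * D + m + 1 - 3 * D = m + 1 by omega,
    Nat.add_sub_cancel_left]
  have e : ∏ b ∈ range (3 * D), (A b).eval t.1 =
      ∏ b ∈ range (3 * D), ∏ j ∈ range n, ((D : ℝ) * (t.1 - n) + ((b * n + j : ℕ) : ℝ)) := by
    refine prod_congr rfl fun b _ => ?_
    rw [hA, Polynomial.eval_prod]
    refine prod_congr rfl fun j _ => ?_
    simp
    ring
  rw [prod_range_succ (fun j : ℕ => (D : ℝ) * (t.1 - n) + j) (3 * D * n),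
    prod_range_mul_eq _ (3 * D) n, ← e]
  simp only [Polynomial.eval_add, Polynomial.eval_mul, Polynomial.eval_C, Polynomial.eval_X]
  generalize ∏ j ∈ range (n + 1), (t.1 + (j : ℝ)) = Q at h0
  generalize ∏ b ∈ range (3 * D), (A b).eval t.1 = P
  rw [div_pow]
  push_cast
  field_simp
  ring

theorem fszR_neg_sub {n D s : ℕ} (hn : Even n) (hs : Odd s) (t : ℝ) :
    fszR n D s (-n - t) = -fszR n D s t := by
  have h1 : ∏ j ∈ range (3 * D * n + 1), ((D : ℝ) * (-n - t - n) + j) =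
      -∏ j ∈ range (3 * D * n + 1), ((D : ℝ) * (t - n) + j) := by
    rw [← prod_range_reflect]
    have e : ∏ j ∈ range (3 * D * n + 1), (-1 : ℝ) = -1 := by
      rw [prod_const, card_range, Odd.neg_one_pow]
      exact (hn.mul_left _).add_one
    rw [neg_eq_neg_one_mul (∏ j ∈ range (3 * D * n + 1), _), ← e, ← prod_mul_distrib]
    refine prod_congr rfl fun j hj => ?_
    have hj := mem_range.1 hj
    rw [Nat.add_sub_cancel, Nat.cast_sub (by omega)]
    push_cast
    ring
  have h2 : (∏ j ∈ range (n + 1), (-n - t + j)) ^ (s + 1) =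
      (∏ j ∈ range (n + 1), (t + j)) ^ (s + 1) := by
    rw [← prod_range_reflect, ← prod_pow, ← prod_pow]
    refine prod_congr rfl fun j hj => ?_
    have hj := mem_range.1 hj
    rw [← Even.neg_pow hs.add_one, Nat.add_sub_cancel, Nat.cast_sub (by omega)]
    congr 1
    ring
  rw [fszR, fszR, h1, h2]
  ring

theorem exists_fszR_eq_sum {n d D s : ℕ} (hn : 0 < n) (hn2 : Even n) (hD : 0 < D)
    (hs : 3 * D ≤ s) (hs2 : Odd s) (hd0 : d ≠ 0) (hd : ∀ j, 0 < j → j ≤ n → j ∣ d) :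
    ∃ b : ℕ → ℕ → ℤ,
      (∀ t : ℝ, (∀ k ≤ n, t + k ≠ 0) → 2 * fszR n D s t =
        ∑ i ∈ range (s + 1), ∑ k ∈ range (n + 1), b i k / ((d : ℝ) ^ (s - i) * (t + k) ^ (i + 1))) ∧
      ∀ i, Odd i → ∑ k ∈ range (n + 1), b i k = 0 := by
  obtain ⟨c, hc⟩ := (Submodule.mem_span_range_iff_exists_fun ℤ).1
    (fszR_mem_partialFractions hn hD hs hd0 hd)
  obtain ⟨a, ha⟩ : ∃ a : ℕ → ℕ → ℤ, ∀ (i : Fin (s + 1)) (k : Fin (n + 1)), a i k = c (i, k) :=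
    ⟨fun i k => if h : i < s + 1 ∧ k < n + 1 then c (⟨i, h.1⟩, ⟨k, h.2⟩) else 0,
      fun i k => dif_pos ⟨i.2, k.2⟩⟩
  have hR : ∀ t : ℝ, (∀ k ≤ n, t + k ≠ 0) → fszR n D s t = ∑ i ∈ range (s + 1),
      ∑ k ∈ range (n + 1), a i k / ((d : ℝ) ^ (s - i) * (t + k) ^ (i + 1)) := by
    intro t ht
    have h := (congrFun hc ⟨t, ht⟩).symm
    rw [Finset.sum_apply, Fintype.sum_prod_type] at h
    simp only at h
    rw [h, sum_range]
    refine sum_congr rfl fun i _ => ?_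
    rw [sum_range]
    refine sum_congr rfl fun k _ => ?_
    rw [Pi.smul_apply, zsmul_eq_mul, ha, div_eq_mul_inv, mul_inv, Nat.add_sub_cancel]
  refine ⟨fun i k => a i k + (-1) ^ i * a i (n - k), fun t ht => ?_, fun i hi => ?_⟩
  · have ht' : ∀ k ≤ n, -(n : ℝ) - t + k ≠ 0 := by
      intro k hk h
      refine ht (n - k) (by omega) ?_
      rw [Nat.cast_sub hk]
      linarith
    have h : 2 * fszR n D s t = fszR n D s t - fszR n D s (-n - t) := by
      rw [fszR_neg_sub hn2 hs2]
      ring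
    rw [h, hR t ht, hR _ ht', ← sum_sub_distrib]
    refine sum_congr rfl fun i _ => ?_
    rw [← sum_range_reflect (fun k => (a i k : ℝ) / ((d : ℝ) ^ (s - i) * (-n - t + k) ^ (i + 1))),
      ← sum_sub_distrib]
    refine sum_congr rfl fun k hk => ?_
    have hk := mem_range.1 hk
    have e : (-(n : ℝ) - t + (n + 1 - 1 - k : ℕ)) ^ (i + 1) = (-1) ^ (i + 1) *
        (t + k) ^ (i + 1) := by
      rw [← mul_pow, Nat.add_sub_cancel, Nat.cast_sub (by omega)]
      congr 1
      ring
    rw [e, Nat.add_sub_cancel]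
    have n1 : (d : ℝ) ≠ 0 := by exact_mod_cast hd0
    have n2 := ht k (by omega)
    have n3 : ((-1 : ℝ) ^ i) ≠ 0 := pow_ne_zero _ (by norm_num)
    have n4 : ((-1 : ℝ) ^ i) * (-1) ^ i = 1 := by rw [← mul_pow]; simp
    push_cast
    rw [pow_succ (-1 : ℝ)]
    field_simp
    linear_combination (-(a i (n - k) : ℝ)) * n4
  · have h := sum_range_reflect (fun k => a i k) (n + 1)
    simp only [Nat.add_sub_cancel] at h
    rw [sum_add_distrib, ← mul_sum, h, hi.neg_one_pow]
    ring

theorem not_dvd_den_sum {ι : Type*} {p : ℕ} (hp : p.Prime) (t : Finset ι) (f : ι → ℚ)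
    (h : ∀ i ∈ t, ¬ p ∣ (f i).den) : ¬ p ∣ (∑ i ∈ t, f i).den := by
  classical
  induction t using Finset.induction_on with
  | empty => simpa using hp.one_lt.ne'
  | insert a t ha ih =>
    rw [sum_insert ha]
    intro hdvd
    rcases hp.dvd_mul.1 (hdvd.trans (Rat.add_den_dvd _ _)) with h1 | h1
    · exact h a (mem_insert_self a t) h1
    · exact ih (fun i hi => h i (mem_insert_of_mem hi)) h1

theorem not_dvd_den_intCast_mul_pow {p : ℕ} (hp : p.Prime) (z : ℤ) {y : ℚ} (h : ¬ p ∣ y.den)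
    (i : ℕ) : ¬ p ∣ (z * y ^ i).den := by
  intro hdvd
  have h1 := hdvd.trans (Rat.mul_den_dvd _ _)
  rw [Rat.den_intCast, one_mul, Rat.den_pow] at h1
  exact h (hp.dvd_of_dvd_pow h1)

theorem not_dvd_den_of_mul_sub_eq {p : ℕ} (hp : p.Prime) {y y' : ℚ} {c : ℤ}
    (h : c * (y' - y) = y * y') (hy : p ∣ y.den) : ¬ p ∣ y'.den := by
  intro hy'
  have e : (c * (y'.num * y.den - y.num * y'.den) : ℤ) = y.num * y'.num := by
    have n1 : (y.den : ℚ) ≠ 0 := by exact_mod_cast y.den_nz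
    have n2 : (y'.den : ℚ) ≠ 0 := by exact_mod_cast y'.den_nz
    rw [← Rat.num_div_den y, ← Rat.num_div_den y'] at h
    field_simp at h
    have h' : ((c * (y'.num * y.den - y.num * y'.den) : ℤ) : ℚ) = (y.num * y'.num : ℤ) := by
      push_cast
      linear_combination h
    exact_mod_cast h'
  have h1 : (p : ℤ) ∣ y.num * y'.num := by
    rw [← e]
    refine Dvd.dvd.mul_left (dvd_sub ?_ ?_) _
    · exact Dvd.dvd.mul_left (by exact_mod_cast hy) _
    · exact Dvd.dvd.mul_left (by exact_mod_cast hy') _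
  rcases (Nat.prime_iff_prime_int.1 hp).dvd_or_dvd h1 with h2 | h2
  · exact hp.one_lt.ne' (Nat.Coprime.eq_one_of_dvd
      (Nat.Coprime.coprime_dvd_left (Int.natCast_dvd.1 h2)
          (Nat.Coprime.coprime_dvd_right hy y.reduced))
      dvd_rfl |>.trans rfl)
  · exact hp.one_lt.ne' (Nat.Coprime.eq_one_of_dvd
      (Nat.Coprime.coprime_dvd_left (Int.natCast_dvd.1 h2)
        (Nat.Coprime.coprime_dvd_right hy' y'.reduced))
      dvd_rfl |>.trans rfl)

theorem exists_int_eq_of_forall_not_dvd_den {r : ℚ} (h : ∀ p : ℕ, p.Prime → ¬ p ∣ r.den) :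
    ∃ z : ℤ, r = z := by
  refine ⟨r.num, ?_⟩
  have : r.den = 1 := by
    by_contra h1
    obtain ⟨p, hp, hpd⟩ := Nat.exists_prime_and_dvd h1
    exact h p hp hpd
  exact (Rat.den_eq_one_iff r).1 this |>.symm

theorem exists_int_eq_sum_Ico {n s μ : ℕ} (b : ℕ → ℕ → ℤ) (y : ℕ → ℚ) (hμ : μ ≤ n + 1)
    (hy : ∀ k ≤ n, ∀ k' ≤ n, k ≠ k' → ∃ c : ℤ, c * (y k' - y k) = y k * y k')
    (h0 : ∑ k ∈ range (n + 1), ∑ i ∈ range (s + 1), b i k * y k ^ (i + 1) = 0) :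
    ∃ z : ℤ, ∑ k ∈ Ico μ (n + 1), ∑ i ∈ range (s + 1), b i k * y k ^ (i + 1) = z := by
  refine exists_int_eq_of_forall_not_dvd_den fun p hp => ?_
  have hg : ∀ t : Finset ℕ, (∀ k ∈ t, ¬ p ∣ (y k).den) →
      ¬ p ∣ (∑ k ∈ t, ∑ i ∈ range (s + 1), b i k * y k ^ (i + 1)).den := fun t ht =>
    not_dvd_den_sum hp _ _ fun k hk => not_dvd_den_sum hp _ _ fun i _ =>
      not_dvd_den_intCast_mul_pow hp _ (ht k hk) _
  by_cases hbad : ∃ k ∈ Ico μ (n + 1), p ∣ (y k).den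
  · obtain ⟨k, hk, hpk⟩ := hbad
    have hk := mem_Ico.1 hk
    have e : ∑ k ∈ Ico μ (n + 1), ∑ i ∈ range (s + 1), (b i k : ℚ) * y k ^ (i + 1) =
        -∑ k ∈ range μ, ∑ i ∈ range (s + 1), (b i k : ℚ) * y k ^ (i + 1) := by
      rw [← sum_range_add_sum_Ico _ hμ] at h0
      linarith
    rw [e, Rat.neg_den]
    refine hg _ fun k' hk' => ?_
    have hk' := mem_range.1 hk'
    obtain ⟨c, hc⟩ := hy k (by omega) k' (by omega) (by omega)
    exact not_dvd_den_of_mul_sub_eq hp hc hpk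
  · push Not at hbad
    exact hg _ hbad

theorem exists_int_mul_sub_div {n d k k' : ℕ} (hd : ∀ j, 0 < j → j ≤ n → j ∣ d)
    (hk : k ≤ n) (hk' : k' ≤ n) (hne : k ≠ k') {x : ℚ} (h1 : x + k ≠ 0) (h2 : x + k' ≠ 0) :
    ∃ c : ℤ, c * ((d : ℚ) / (x + k') - d / (x + k)) = d / (x + k) * (d / (x + k')) := by
  obtain ⟨c, hc⟩ : ∃ c : ℤ, (d : ℚ) = c * ((k : ℚ) - k') := by
    rcases lt_or_gt_of_ne hne with h | h
    · obtain ⟨c, hc⟩ := hd (k' - k) (by omega) (by omega)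
      refine ⟨-c, ?_⟩
      rw [hc]
      push_cast [Nat.cast_sub h.le]
      ring
    · obtain ⟨c, hc⟩ := hd (k - k') (by omega) (by omega)
      refine ⟨c, ?_⟩
      rw [hc]
      push_cast [Nat.cast_sub h.le]
      ring
  refine ⟨c, ?_⟩
  field_simp
  linear_combination (-(d : ℚ)) * hc

theorem exists_int_eq_sum_sum {n d s j D : ℕ} (b : ℕ → ℕ → ℤ)
    (hd : ∀ j, 0 < j → j ≤ n → j ∣ d) (hj : 0 < j) (hjD : j ≤ D)
    (h0 : j < D → ∀ μ : ℕ, 1 ≤ μ → μ ≤ n → ∑ k ∈ range (n + 1), ∑ i ∈ range (s + 1),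
      b i k * ((d : ℚ) / ((j : ℚ) / D - μ + k)) ^ (i + 1) = 0) :
    ∃ z : ℤ, ∑ k ∈ range (n + 1), ∑ l ∈ range k, ∑ i ∈ range (s + 1),
      b i k * ((d : ℚ) / (l + (j : ℚ) / D)) ^ (i + 1) = z := by
  have hD : (D : ℚ) ≠ 0 := by
    have : 0 < D := by omega
    positivity
  rcases hjD.lt_or_eq with h | rfl
  · have hμ : ∀ μ ∈ range n, ∃ z : ℤ, ∑ k ∈ Ico (μ + 1) (n + 1), ∑ i ∈ range (s + 1),
        b i k * ((d : ℚ) / ((j : ℚ) / D - (μ + 1 : ℕ) + k)) ^ (i + 1) = z := by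
      intro μ hμ
      have hμ := mem_range.1 hμ
      refine exists_int_eq_sum_Ico b _ (by omega) (fun k hk k' hk' hne => ?_)
        (h0 h (μ + 1) (by omega) (by omega))
      have hz : ∀ k : ℕ, (j : ℚ) / D - (μ + 1 : ℕ) + k ≠ 0 := by
        intro k hk
        have h1 : (0 : ℚ) < (j : ℚ) / D := by
          have : 0 < D := by omega
          positivity
        have h2 : (j : ℚ) / D < 1 := by
          rw [div_lt_one (by have : 0 < D := by omega
                             positivity)]
          exact_mod_cast h
        have h3 : (k : ℚ) < (μ + 1 : ℕ) := by linarith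
        have h4 : ((μ + 1 : ℕ) : ℚ) < k + 1 := by linarith
        have h5 : k < μ + 1 := by exact_mod_cast h3
        have h6 : μ + 1 < k + 1 := by exact_mod_cast h4
        omega
      exact exists_int_mul_sub_div hd hk hk' hne (hz k) (hz k')
    choose! z hz using hμ
    refine ⟨∑ μ ∈ range n, z μ, ?_⟩
    push_cast
    rw [← sum_congr rfl hz]
    have e : ∀ k ∈ range (n + 1), ∑ l ∈ range k, ∑ i ∈ range (s + 1),
        (b i k : ℚ) * ((d : ℚ) / (l + (j : ℚ) / D)) ^ (i + 1) =
        ∑ μ ∈ range k, ∑ i ∈ range (s + 1),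
        b i k * ((d : ℚ) / ((j : ℚ) / D - (μ + 1 : ℕ) + k)) ^ (i + 1) := by
      intro k _
      rw [← sum_range_reflect]
      refine sum_congr rfl fun l hl => sum_congr rfl fun i _ => ?_
      have hl := mem_range.1 hl
      congr 3
      rw [Nat.sub_sub, Nat.cast_sub (by omega)]
      push_cast
      ring
    rw [sum_congr rfl e]
    refine sum_comm' fun k μ => ?_
    simp only [mem_range, mem_Ico]
    omega
  · rw [div_self hD]
    have hl : ∀ l ∈ range n, ∃ z : ℤ, (d : ℚ) / (l + 1) = z := by
      intro l hl
      obtain ⟨c, hc⟩ := hd (l + 1) (by omega) (by have := mem_range.1 hl; omega)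
      refine ⟨c, ?_⟩
      rw [hc]
      push_cast
      field_simp
    choose! z hz using hl
    refine ⟨∑ k ∈ range (n + 1), ∑ l ∈ range k, ∑ i ∈ range (s + 1), b i k * z l ^ (i + 1), ?_⟩
    push_cast
    refine sum_congr rfl fun k hk => sum_congr rfl fun l hl => sum_congr rfl fun i _ => ?_
    have hk := mem_range.1 hk
    have hl := mem_range.1 hl
    rw [hz l (mem_range.2 (by omega))]

theorem factorial_mul_le_prod {n : ℕ} (hn : 0 < n) {t : ℝ} (ht : n ≤ t) :
    n.factorial * 4 ^ n ≤ 2 * ∏ j ∈ range (n + 1), (t + j) := by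
  have h1 : ∏ j ∈ range (n + 1), ((n : ℝ) + j) = n * (n.factorial * n.centralBinom) := by
    have : ∏ j ∈ range n, (n + (j + 1)) = n.factorial * n.centralBinom := by
      rw [Nat.centralBinom, two_mul, ← Nat.ascFactorial_eq_factorial_mul_choose,
        Nat.ascFactorial_eq_prod_range]
      exact prod_congr rfl fun j _ => by ring
    rw [prod_range_succ', mul_comm]
    have h : ((∏ j ∈ range n, (n + (j + 1)) : ℕ) : ℝ) = (n.factorial * n.centralBinom : ℕ) := by
      rw [this]
    push_cast at h ⊢
    rw [h]
    simp
  have h2 : ∏ j ∈ range (n + 1), ((n : ℝ) + j) ≤ ∏ j ∈ range (n + 1), (t + j) :=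
    prod_le_prod (fun _ _ => by positivity) fun _ _ => by linarith
  have h3 : (4 : ℝ) ^ n ≤ 2 * n * n.centralBinom := by
    exact_mod_cast Nat.four_pow_le_two_mul_self_mul_centralBinom n hn
  have h4 : (0 : ℝ) < n.factorial := by positivity
  nlinarith

theorem fszR_nonneg {n D s : ℕ} {t : ℝ} (ht : n ≤ t) : 0 ≤ fszR n D s t := by
  have h0 : (0 : ℝ) ≤ t := le_trans (by positivity) ht
  have h1 : ∀ j : ℕ, (0 : ℝ) ≤ D * (t - n) + j := fun j =>
    add_nonneg (mul_nonneg (by positivity) (by linarith)) (by positivity)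
  exact div_nonneg (mul_nonneg (prod_nonneg fun j _ => h1 j) (by positivity))
    (mul_nonneg (by positivity) (pow_nonneg (prod_nonneg fun j _ => by positivity) _))

theorem fszR_le {n D s : ℕ} {t : ℝ} (hn : 0 < n) (hD : 0 < D) (hs : 3 * D ≤ s) (ht : n ≤ t) :
    fszR n D s t ≤
      (3 * D) ^ (3 * D * n + 1) * (2 / 4 ^ n) ^ (s + 1 - 3 * D) * (1 / t ^ 2) := by
  obtain ⟨e, he⟩ : ∃ e, s + 1 - 3 * D = e := ⟨_, rfl⟩
  have hse : s + 1 = 3 * D + e := by omega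
  have hn1 : (1 : ℝ) ≤ n := by exact_mod_cast hn
  have ht1 : 1 ≤ t := hn1.trans ht
  have ht0 : 0 < t := by linarith
  have hD1 : (1 : ℝ) ≤ D := by exact_mod_cast hD
  have hD0 : (0 : ℝ) < D := by linarith
  rw [fszR, he, hse, pow_add (∏ j ∈ range (n + 1), (t + (j : ℝ)))]
  have hnum : ∏ j ∈ range (3 * D * n + 1), ((D : ℝ) * (t - n) + j) ≤
      (3 * D * t) ^ (3 * D * n + 1) := by
    rw [← card_range (3 * D * n + 1), ← prod_const, card_range]
    refine prod_le_prod (fun j _ => ?_) fun j hj => ?_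
    · exact add_nonneg (mul_nonneg (by positivity) (by linarith)) (by positivity)
    · have hj : j ≤ 3 * D * n := by have := mem_range.1 hj; omega
      have hj' : (j : ℝ) ≤ 3 * D * n := by exact_mod_cast hj
      nlinarith
  have hQ1 : t ^ (n + 1) ≤ ∏ j ∈ range (n + 1), (t + (j : ℝ)) := by
    rw [← card_range (n + 1), ← prod_const, card_range]
    exact prod_le_prod (fun j _ => ht0.le) fun j _ => by
      have : (0 : ℝ) ≤ j := by positivity
      linarith
  have hQ2 := factorial_mul_le_prod hn ht
  have hQ0 : 0 < ∏ j ∈ range (n + 1), (t + (j : ℝ)) := prod_pos fun _ _ => by positivity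
  generalize ∏ j ∈ range (n + 1), (t + (j : ℝ)) = Q at *
  generalize ∏ j ∈ range (3 * D * n + 1), ((D : ℝ) * (t - n) + j) = P at *
  have h1 : (n.factorial : ℝ) ^ e ≤ (2 / 4 ^ n) ^ e * Q ^ e := by
    rw [← mul_pow]
    refine pow_le_pow_left₀ (by positivity) ?_ e
    rw [div_mul_eq_mul_div, le_div_iff₀ (by positivity)]
    exact hQ2
  have h2 : t ^ (3 * D * n + 1) * t ^ 2 ≤ Q ^ (3 * D) := by
    refine le_trans ?_ (pow_le_pow_left₀ (by positivity) hQ1 _)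
    rw [← pow_mul, ← pow_add]
    refine pow_le_pow_right₀ ht1 ?_
    nlinarith
  have h3 : P * t ^ 2 ≤ (3 * D) ^ (3 * D * n + 1) * Q ^ (3 * D) := by
    calc P * t ^ 2 ≤ (3 * D * t) ^ (3 * D * n + 1) * t ^ 2 := by gcongr
      _ = (3 * D) ^ (3 * D * n + 1) * (t ^ (3 * D * n + 1) * t ^ 2) := by
        rw [mul_pow]; ring
      _ ≤ _ := by gcongr
  rw [div_le_iff₀ (by positivity), mul_one_div, div_mul_eq_mul_div, le_div_iff₀ (by positivity)]
  calc P * n.factorial ^ e * t ^ 2 = (P * t ^ 2) * n.factorial ^ e := by ring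
    _ ≤ ((3 * D) ^ (3 * D * n + 1) * Q ^ (3 * D)) * ((2 / 4 ^ n) ^ e * Q ^ e) :=
      mul_le_mul h3 h1 (by positivity) (by positivity)
    _ = ((3 * D) ^ (3 * D * n + 1) * Q ^ (3 * D)) * ((2 / 4 ^ n) ^ e * Q ^ e) * 1 := by ring
    _ ≤ ((3 * D) ^ (3 * D * n + 1) * Q ^ (3 * D)) * ((2 / 4 ^ n) ^ e * Q ^ e) * D := by gcongr
    _ = _ := by ring

theorem hasSum_sub_add {g : ℕ → ℝ} (hg : Antitone g) (h0 : Tendsto g atTop (𝓝 0)) (k : ℕ) :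
    HasSum (fun m => g m - g (m + k)) (∑ l ∈ range k, g l) := by
  rw [hasSum_iff_tendsto_nat_of_nonneg fun m => sub_nonneg.2 (hg (by omega))]
  have e : ∀ M, ∑ m ∈ range M, (g m - g (m + k)) =
      ∑ l ∈ range k, g l - ∑ l ∈ range k, g (M + l) := by
    intro M
    have h1 := sum_range_add g M k
    have h2 := sum_range_add g k M
    rw [add_comm k M] at h2
    have h3 : ∑ m ∈ range M, g (m + k) = ∑ m ∈ range M, g (k + m) :=
      sum_congr rfl fun m _ => by rw [add_comm]
    rw [sum_sub_distrib, h3]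
    linarith
  simp only [e]
  have : Tendsto (fun M => ∑ l ∈ range k, g (M + l)) atTop (𝓝 (∑ l ∈ range k, 0)) :=
    tendsto_finsetSum _ fun l _ => h0.comp (tendsto_add_atTop_nat l)
  simpa using this.const_sub (∑ l ∈ range k, g l)

theorem antitone_one_div_add_pow {x : ℝ} (hx : 0 < x) (i : ℕ) :
    Antitone fun m : ℕ => 1 / ((m : ℝ) + x) ^ i := fun a b hab => by
  have : (a : ℝ) ≤ b := by exact_mod_cast hab
  exact one_div_le_one_div_of_le (by positivity) (by gcongr)

theorem tendsto_one_div_add_pow (x : ℝ) (i : ℕ) :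
    Tendsto (fun m : ℕ => 1 / ((m : ℝ) + x) ^ (i + 1)) atTop (𝓝 0) :=
  tendsto_const_nhds.div_atTop ((tendsto_pow_atTop (by omega)).comp
    (tendsto_atTop_add_const_right _ _ tendsto_natCast_atTop_atTop))

theorem summable_one_div_add_pow {x : ℝ} (hx : 0 < x) {i : ℕ} (hi : 2 ≤ i) :
    Summable fun m : ℕ => 1 / ((m : ℝ) + x) ^ i := by
  have h := (Real.summable_one_div_nat_add_rpow x i).2 (by exact_mod_cast hi)
  refine h.congr fun m => ?_
  rw [abs_of_pos (by positivity), Real.rpow_natCast]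

theorem fszR_eq_zero {n D s : ℕ} {t : ℝ} (i : ℕ) (hi : i ≤ 3 * D * n)
    (h : (D : ℝ) * (t - n) + i = 0) : fszR n D s t = 0 := by
  rw [fszR, prod_eq_zero (mem_range.2 (Nat.lt_succ_of_le hi)) h, zero_mul, zero_div]

theorem fszR_add_div_eq_zero {n D s m j : ℕ} (hm : m < n) (hj : j ≤ D) (hD : 0 < D) :
    fszR n D s (m + (j : ℝ) / D) = 0 := by
  have h1 : D * m + j ≤ D * n := by nlinarith
  refine fszR_eq_zero (D * n - (D * m + j)) ?_ ?_
  · have : D * n ≤ 3 * D * n := by nlinarith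
    omega
  · have : (D : ℝ) ≠ 0 := by positivity
    rw [Nat.cast_sub h1]
    push_cast
    field_simp
    ring

theorem fszR_div_sub_eq_zero {n D s μ j : ℕ} (hμ1 : 1 ≤ μ) (hμ : μ ≤ n) (hj : j ≤ D)
    (hD : 0 < D) : fszR n D s ((j : ℝ) / D - μ) = 0 := by
  have h1 : j ≤ D * (μ + n) := by nlinarith
  refine fszR_eq_zero (D * (μ + n) - j) ?_ ?_
  · have : D * (μ + n) ≤ 3 * D * n := by nlinarith
    omega
  · have : (D : ℝ) ≠ 0 := by positivity
    rw [Nat.cast_sub h1]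
    push_cast
    field_simp
    ring

theorem summable_fszR {n D s j : ℕ} (hn : 0 < n) (hj : 0 < j) (hjD : j ≤ D) (hs : 3 * D ≤ s) :
    Summable fun m : ℕ => fszR n D s (m + (j : ℝ) / D) := by
  have hD : 0 < D := by omega
  have hx : (0 : ℝ) < (j : ℝ) / D := by positivity
  have h := (summable_one_div_add_pow hx le_rfl).mul_left
    ((3 * D : ℝ) ^ (3 * D * n + 1) * (2 / 4 ^ n) ^ (s + 1 - 3 * D))
  have hcase : ∀ m : ℕ, m < n ∨ (n : ℝ) ≤ m + (j : ℝ) / D := fun m => by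
    refine (lt_or_ge m n).imp_right fun h => ?_
    have : (n : ℝ) ≤ m := by exact_mod_cast h
    linarith
  refine Summable.of_nonneg_of_le (fun m => ?_) (fun m => ?_) h
  · rcases hcase m with h | h
    · rw [fszR_add_div_eq_zero h hjD hD]
    · exact fszR_nonneg h
  · rcases hcase m with h | h
    · rw [fszR_add_div_eq_zero h hjD hD]
      positivity
    · exact fszR_le hn hD hs h

theorem exists_hasSum_fszR {n d D s : ℕ} (hn : 0 < n) (hn2 : Even n) (hD : 0 < D)
    (hs : 3 * D ≤ s) (hs2 : Odd s) (hd0 : d ≠ 0) (hd : ∀ j, 0 < j → j ≤ n → j ∣ d) :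
    ∃ N M : ℕ → ℤ, ∀ j, 0 < j → j ≤ D →
      HasSum (fun m : ℕ => 2 * (d : ℝ) ^ (s + 1) * fszR n D s (m + (j : ℝ) / D))
        (∑ i ∈ (Icc 3 s).filter Odd, N i * (∑' m : ℕ, 1 / ((m : ℝ) + (j : ℝ) / D) ^ i) - M j) := by
  obtain ⟨b, hb, hb0⟩ := exists_fszR_eq_sum hn hn2 hD hs hs2 hd0 hd
  have hd0' : (d : ℝ) ≠ 0 := by exact_mod_cast hd0
  have hb' : ∀ t : ℝ, (∀ k ≤ n, t + k ≠ 0) → 2 * (d : ℝ) ^ (s + 1) * fszR n D s t =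
      ∑ k ∈ range (n + 1), ∑ i ∈ range (s + 1), b i k * ((d : ℝ) / (t + k)) ^ (i + 1) := by
    intro t ht
    rw [mul_right_comm, hb t ht, sum_comm, sum_mul]
    refine sum_congr rfl fun k hk => ?_
    rw [sum_mul]
    refine sum_congr rfl fun i hi => ?_
    have h1 := ht k (by have := mem_range.1 hk; omega)
    have h2 : (d : ℝ) ^ (s + 1) = d ^ (s - i) * d ^ (i + 1) := by
      rw [← pow_add]
      congr 1
      have := mem_range.1 hi
      omega
    rw [h2, div_pow]
    field_simp
  have h_int : ∀ j, 0 < j → j ≤ D → ∃ z : ℤ, ∑ k ∈ range (n + 1), ∑ l ∈ range k,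
      ∑ i ∈ range (s + 1), b i k * ((d : ℝ) / (l + (j : ℝ) / D)) ^ (i + 1) = z := by
    intro j hj hjD
    obtain ⟨z, hz⟩ := exists_int_eq_sum_sum (s := s) b hd hj hjD (fun hlt μ hμ1 hμ => by
      have h := hb' ((j : ℝ) / D - μ) (fun k _ h => by
        have h1 : (0 : ℝ) < (j : ℝ) / D := by positivity
        have h2 : (j : ℝ) / D < 1 := by
          rw [div_lt_one (by positivity)]
          exact_mod_cast hlt
        have h3 : (k : ℝ) < μ := by linarith
        have h4 : (μ : ℝ) < k + 1 := by linarith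
        have h5 : k < μ := by exact_mod_cast h3
        have h6 : μ < k + 1 := by exact_mod_cast h4
        omega)
      rw [fszR_div_sub_eq_zero hμ1 hμ hjD hD, mul_zero] at h
      exact Rat.cast_injective (α := ℝ) (by push_cast; exact h.symm))
    have hz' := congrArg (Rat.cast : ℚ → ℝ) hz
    push_cast at hz'
    exact ⟨z, hz'⟩
  choose! M hM using h_int
  set N : ℕ → ℤ := fun i => (∑ k ∈ range (n + 1), b i k) * d ^ (i + 1) with hN
  have htel : ∀ j, 0 < j → j ≤ D → HasSum (fun m : ℕ => ∑ k ∈ range (n + 1), ∑ i ∈ range (s + 1),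
      (b i k * (d : ℝ) ^ (i + 1)) * (1 / ((m : ℝ) + (j : ℝ) / D) ^ (i + 1) -
        1 / (((m + k : ℕ) : ℝ) + (j : ℝ) / D) ^ (i + 1))) (M j) := by
    intro j hj hjD
    have hx : (0 : ℝ) < (j : ℝ) / D := by positivity
    have h := hasSum_sum (s := range (n + 1)) fun k _ => hasSum_sum (s := range (s + 1)) fun i _ =>
      (hasSum_sub_add (antitone_one_div_add_pow hx (i + 1)) (tendsto_one_div_add_pow _ i)
        k).mul_left (b i k * (d : ℝ) ^ (i + 1))
    refine (congrArg (HasSum _) ?_).mp h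
    rw [← hM j hj hjD]
    refine sum_congr rfl fun k _ => ?_
    rw [sum_comm]
    refine sum_congr rfl fun i _ => ?_
    rw [mul_sum]
    refine sum_congr rfl fun l _ => ?_
    rw [div_pow]
    ring
  have hdecomp : ∀ j, 0 < j → j ≤ D → ∀ m : ℕ,
      2 * (d : ℝ) ^ (s + 1) * fszR n D s (m + (j : ℝ) / D) =
      ∑ i ∈ range (s + 1), N i * (1 / ((m : ℝ) + (j : ℝ) / D) ^ (i + 1)) -
      ∑ k ∈ range (n + 1), ∑ i ∈ range (s + 1),
      (b i k * (d : ℝ) ^ (i + 1)) * (1 / ((m : ℝ) + (j : ℝ) / D) ^ (i + 1) -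
        1 / (((m + k : ℕ) : ℝ) + (j : ℝ) / D) ^ (i + 1)) := by
    intro j hj hjD m
    have hx : (0 : ℝ) < (j : ℝ) / D := by positivity
    rw [hb' _ fun k _ => by positivity, eq_sub_iff_add_eq, ← sum_add_distrib]
    have e : ∀ i ∈ range (s + 1), (N i : ℝ) * (1 / ((m : ℝ) + (j : ℝ) / D) ^ (i + 1)) =
        ∑ k ∈ range (n + 1), (b i k * (d : ℝ) ^ (i + 1)) *
            (1 / ((m : ℝ) + (j : ℝ) / D) ^ (i + 1)) := by
      intro i _
      rw [hN]
      push_cast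
      rw [sum_mul, sum_mul]
    rw [sum_congr rfl e, sum_comm (s := range (s + 1))]
    refine sum_congr rfl fun k _ => ?_
    rw [← sum_add_distrib]
    refine sum_congr rfl fun i _ => ?_
    have e2 : (((m + k : ℕ) : ℝ) + (j : ℝ) / D) = (m : ℝ) + (j : ℝ) / D + k := by push_cast; ring
    rw [e2, div_pow]
    ring
  have hNodd : ∀ i, Odd i → N i = 0 := fun i hi => by rw [hN]; simp only; rw [hb0 i hi, zero_mul]
  have hN0 : N 0 = 0 := by
    by_contra hne
    have hne' : (N 0 : ℝ) ≠ 0 := by exact_mod_cast hne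
    have h1 := (summable_fszR (s := s) hn hD le_rfl hs).mul_left (2 * (d : ℝ) ^ (s + 1))
    have h2 := h1.add (htel D hD le_rfl).summable
    have h3 : Summable fun m : ℕ => ∑ i ∈ range s,
        (N (i + 1) : ℝ) * (1 / ((m : ℝ) + (D : ℝ) / D) ^ (i + 1 + 1)) :=
      summable_sum fun i _ => (summable_one_div_add_pow (by positivity) (by omega)).mul_left _
    have h4 := (h2.sub h3).mul_left (N 0 : ℝ)⁻¹
    refine Real.not_summable_one_div_natCast ((summable_nat_add_iff 1).1 (h4.congr fun m => ?_))
    rw [hdecomp D hD le_rfl, sum_range_succ']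
    have : (D : ℝ) ≠ 0 := by positivity
    rw [div_self this]
    push_cast
    field_simp
    ring
  refine ⟨fun i => N (i - 1), M, fun j hj hjD => ?_⟩
  have hx : (0 : ℝ) < (j : ℝ) / D := by positivity
  have h : HasSum (fun m : ℕ => ∑ i ∈ (Icc 3 s).filter Odd,
      (N (i - 1) : ℝ) * (1 / ((m : ℝ) + (j : ℝ) / D) ^ i))
      (∑ i ∈ (Icc 3 s).filter Odd, N (i - 1) * (∑' m : ℕ, 1 / ((m : ℝ) + (j : ℝ) / D) ^ i)) :=
    hasSum_sum fun i hi => (summable_one_div_add_pow hx (by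
      have := mem_Icc.1 (mem_filter.1 hi).1
      omega)).hasSum.mul_left _
  refine (h.sub (htel j hj hjD)).congr_fun fun m => ?_
  rw [hdecomp j hj hjD]
  congr 1
  rw [← sum_filter_of_ne (p := fun i => Even i ∧ 2 ≤ i)]
  · refine sum_nbij' (fun i => i + 1) (fun i => i - 1) ?_ ?_ ?_ ?_ ?_ <;>
      simp only [mem_filter, mem_range, mem_Icc, Nat.even_iff, Nat.odd_iff] at *
    · omega
    · omega
    · omega
    · omega
    · intro i _
      rw [Nat.add_sub_cancel]
  · intro i _ h
    have hNi : N i ≠ 0 := by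
      rintro h0
      rw [h0] at h
      simp at h
    have h1 : Even i := by
      by_contra h1
      exact hNi (hNodd i (Nat.not_even_iff_odd.1 h1))
    refine ⟨h1, ?_⟩
    by_contra h2
    have : i = 0 := by
      rw [Nat.even_iff] at h1
      omega
    exact hNi (this ▸ hN0)

theorem HasSum.sum_residue {g : ℕ → ℝ} {a : ℝ} (hg : HasSum g a) {e : ℕ} (he : 0 < e) :
    ∑ j ∈ range e, ∑' m : ℕ, g (m * e + j) = a := by
  have : NeZero e := ⟨he.ne'⟩
  have h1 := ((Nat.divModEquiv e).symm.hasSum_iff (f := g)).2 hg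
  have h2 := ((Equiv.prodComm (Fin e) ℕ).hasSum_iff).2 h1
  have h3 := h2.prod_fiberwise fun j => (h2.summable.prod_factor j).hasSum
  rw [sum_range]
  exact (hasSum_fintype _).unique h3

theorem Summable.residue {g : ℕ → ℝ} (hg : Summable g) {e : ℕ} (he : 0 < e) (j : ℕ) :
    Summable fun m : ℕ => g (m * e + j) :=
  hg.comp_injective fun a b h => by
    have : a * e = b * e := by simpa using h
    exact Nat.eq_of_mul_eq_mul_right he this

theorem abs_tsum_residue_sub_le {u : ℕ → ℝ} {U T : ℝ} (hu : HasSum u U)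
    (hT : HasSum (fun h => |u (h + 1) - u h|) T) {D j : ℕ} (hj : j < D) :
    |∑' m : ℕ, u (m * D + j) - U / D| ≤ 2 * T := by
  have hD : 0 < D := by omega
  have hstep : ∀ i, |∑' m : ℕ, u (m * D + (i + 1)) - ∑' m : ℕ, u (m * D + i)| ≤
      ∑' m : ℕ, |u (m * D + i + 1) - u (m * D + i)| := by
    intro i
    rw [← (hu.summable.residue hD _).tsum_sub (hu.summable.residue hD _)]
    have h := norm_tsum_le_tsum_norm (f := fun m : ℕ => u (m * D + (i + 1)) - u (m * D + i))
      (hT.summable.residue hD i)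
    exact h
  have hzero : ∀ a < D, |∑' m : ℕ, u (m * D + a) - ∑' m : ℕ, u (m * D + 0)| ≤ T := by
    intro a ha
    have h1 : |∑' m : ℕ, u (m * D + a) - ∑' m : ℕ, u (m * D + 0)| ≤
        ∑ i ∈ range a, ∑' m : ℕ, |u (m * D + i + 1) - u (m * D + i)| := by
      rw [← sum_range_sub (fun i => ∑' m : ℕ, u (m * D + i))]
      exact (abs_sum_le_sum_abs _ _).trans (sum_le_sum fun i _ => hstep i)
    refine h1.trans ?_
    rw [← hT.sum_residue hD]
    exact sum_le_sum_of_subset_of_nonneg (range_subset_range.2 ha.le)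
      fun i _ _ => tsum_nonneg fun m => abs_nonneg _
  have hD' : (0 : ℝ) < D := by positivity
  have hU : |∑' m : ℕ, u (m * D + 0) - U / D| ≤ T := by
    have h1 : (D : ℝ) * (∑' m : ℕ, u (m * D + 0) - U / D) =
        ∑ a ∈ range D, (∑' m : ℕ, u (m * D + 0) - ∑' m : ℕ, u (m * D + a)) := by
      rw [sum_sub_distrib, hu.sum_residue hD, sum_const, card_range, nsmul_eq_mul]
      field_simp
    have h2 : |(D : ℝ) * (∑' m : ℕ, u (m * D + 0) - U / D)| ≤ D * T := by
      rw [h1]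
      refine (abs_sum_le_sum_abs _ _).trans ((sum_le_card_nsmul _ _ T fun a ha => ?_).trans ?_)
      · rw [abs_sub_comm]
        exact hzero a (mem_range.1 ha)
      · simp
    rw [abs_mul, abs_of_pos hD'] at h2
    exact le_of_mul_le_mul_left h2 hD'
  calc _ = |(∑' m : ℕ, u (m * D + j) - ∑' m : ℕ, u (m * D + 0)) +
        (∑' m : ℕ, u (m * D + 0) - U / D)| := by congr 1; ring
    _ ≤ _ := (abs_add_le _ _).trans (by linarith [hzero j hj])

/-- A positive summable sequence whose successive ratios have the shape `(1 + N / (h + 1)) * B h`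
with `B` increasing in `[β, 1]` has small total variation compared to its sum. -/
theorem exists_hasSum_abs_sub_le {u B : ℕ → ℝ} {U N β η : ℝ} (hu0 : ∀ h, 0 ≤ u h)
    (hu : HasSum u U) (hN : 0 < N) (hβ : 0 < β) (hη : 0 < η) (hB : Monotone B)
    (hBβ : ∀ h, β ≤ B h) (hB1 : ∀ h, B h ≤ 1)
    (hq : ∀ h, u (h + 1) = u h * ((1 + N / (h + 1)) * B h)) :
    ∃ T, HasSum (fun h => |u (h + 1) - u h|) T ∧
      T ≤ (η / 2 + (3 / (β ^ 2 * N) + 1 / (β * N)) / (2 * η)) * U := by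
  set K := 3 / (β ^ 2 * N) with hK
  have hK0 : 0 < K := by positivity
  have hup : ∀ h : ℕ, u h / (h + 1) ≤ u (h + 1) / (β * N) := by
    intro h
    rw [hq h]
    have h1 : β * N / (h + 1) ≤ (1 + N / (h + 1)) * B h := by
      have h2 := hBβ h
      have h3 : 0 < N / ((h : ℝ) + 1) := by positivity
      rw [mul_div_assoc]
      nlinarith
    rw [div_le_div_iff₀ (by positivity) (by positivity)]
    rw [div_le_iff₀ (by positivity)] at h1
    have := mul_le_mul_of_nonneg_left h1 (hu0 h)
    linarith
  have hpt : ∀ h : ℕ, |u (h + 1) - u h| ≤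
      η / 2 * u h + 1 / (2 * η) * (K * u (h + 3) + u (h + 2) - 2 * u (h + 1) + u h) := by
    intro h
    set q := (1 + N / ((h : ℝ) + 1)) * B h with hqd
    set q' := (1 + N / (((h + 1 : ℕ) : ℝ) + 1)) * B (h + 1) with hqd'
    have e1 : u (h + 1) = u h * q := hq h
    have e2 : u (h + 2) = u (h + 1) * q' := hq (h + 1)
    have h1 : q - q' ≤ N / ((h + 1) * (h + 2)) := by
      have a1 : N / ((h : ℝ) + 1) - N / (((h + 1 : ℕ) : ℝ) + 1) = N / ((h + 1) * (h + 2)) := by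
        push_cast
        field_simp
        ring
      have a2 := hB (Nat.le_succ h)
      have a3 : 0 < N / (((h + 1 : ℕ) : ℝ) + 1) := by positivity
      have a4 : 0 < N / (((h : ℝ) + 1) * (h + 2)) := by positivity
      have a5 := hB1 h
      rw [hqd, hqd']
      simp only [Nat.succ_eq_add_one] at a2
      nlinarith
    have h2 : u (h + 1) * (N / ((h + 1) * (h + 2))) ≤ K * u (h + 3) := by
      have a1 := hup (h + 1)
      have a2 := hup (h + 2)
      push_cast at a1 a2
      have a3 : u (h + 2) / (h + 1) ≤ 3 * (u (h + 2) / (h + 2 + 1)) := by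
        rw [div_le_iff₀ (by positivity), mul_assoc, div_mul_eq_mul_div, mul_div_assoc',
          le_div_iff₀ (by positivity)]
        nlinarith [mul_nonneg (hu0 (h + 2)) (show (0 : ℝ) ≤ h by positivity), hu0 (h + 2)]
      calc u (h + 1) * (N / ((h + 1) * (h + 2)))
          = N / (h + 1) * (u (h + 1) / (h + 1 + 1)) := by field_simp; ring
        _ ≤ N / (h + 1) * (u (h + 2) / (β * N)) := by gcongr
        _ = 1 / β * (u (h + 2) / (h + 1)) := by field_simp
        _ ≤ 1 / β * (3 * (u (h + 3) / (β * N))) := by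
          refine mul_le_mul_of_nonneg_left (a3.trans ?_) (by positivity)
          linarith
        _ = K * u (h + 3) := by rw [hK]; field_simp
    have h3 : u h * (q - 1) ^ 2 ≤ K * u (h + 3) + u (h + 2) - 2 * u (h + 1) + u h := by
      have a1 := mul_le_mul_of_nonneg_left h1 (hu0 (h + 1))
      have a2 : u h * (q - 1) ^ 2 = u (h + 1) * (q - q') + u (h + 2) - 2 * u (h + 1) + u h := by
        rw [e2, e1]; ring
      linarith
    have h4 : |u (h + 1) - u h| = u h * |q - 1| := by
      rw [e1, ← abs_of_nonneg (hu0 h), ← abs_mul, abs_of_nonneg (hu0 h)]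
      congr 1
      ring
    have h5 : |q - 1| ≤ η / 2 + 1 / (2 * η) * (q - 1) ^ 2 := by
      have a1 : η / 2 + 1 / (2 * η) * (q - 1) ^ 2 - |q - 1| = (η - |q - 1|) ^ 2 / (2 * η) := by
        rw [← sq_abs (q - 1)]
        field_simp
        ring
      have : 0 ≤ (η - |q - 1|) ^ 2 / (2 * η) := by positivity
      linarith
    calc |u (h + 1) - u h| = u h * |q - 1| := h4
      _ ≤ u h * (η / 2 + 1 / (2 * η) * (q - 1) ^ 2) := mul_le_mul_of_nonneg_left h5 (hu0 h)
      _ = η / 2 * u h + 1 / (2 * η) * (u h * (q - 1) ^ 2) := by ring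
      _ ≤ _ := by gcongr
  have s1 := (hasSum_nat_add_iff' 1).2 hu
  have s2 := (hasSum_nat_add_iff' 2).2 hu
  have s3 := (hasSum_nat_add_iff' 3).2 hu
  have hR := (hu.mul_left (η / 2)).add
    (((((s3.mul_left K).add s2).sub (s1.mul_left 2)).add hu).mul_left (1 / (2 * η)))
  have hsum : Summable fun h => |u (h + 1) - u h| :=
    Summable.of_nonneg_of_le (fun _ => abs_nonneg _) hpt hR.summable
  refine ⟨_, hsum.hasSum, (hasSum_le hpt hsum.hasSum hR).trans ?_⟩
  have h01 : u 0 ≤ U / (β * N) := by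
    have a1 := hup 0
    have a2 : u 1 ≤ U := le_hasSum hu 1 fun _ _ => hu0 _
    have a3 : u 1 / (β * N) ≤ U / (β * N) := by gcongr
    simp at a1
    linarith
  simp only [sum_range_succ, sum_range_zero, zero_add]
  have h3 : K * (U - (u 0 + u 1 + u 2)) ≤ K * U := by
    have := hu0 0
    have := hu0 1
    have := hu0 2
    exact mul_le_mul_of_nonneg_left (by linarith) hK0.le
  have h4 : K * (U - (u 0 + u 1 + u 2)) + (U - (u 0 + u 1)) - 2 * (U - u 0) + U ≤
      K * U + U / (β * N) := by
    have := hu0 1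
    linarith
  calc _ ≤ η / 2 * U + 1 / (2 * η) * (K * U + U / (β * N)) := by gcongr
    _ = _ := by ring

theorem prod_range_add_one_add_mul (x : ℝ) (N : ℕ) :
    (∏ j ∈ range N, (x + 1 + j)) * x = (∏ j ∈ range N, (x + j)) * (x + N) := by
  rw [← prod_range_succ (fun j : ℕ => x + (j : ℝ)), prod_range_succ']
  push_cast
  rw [add_zero]
  congr 1
  exact prod_congr rfl fun j _ => by ring

/-- The factor `B` in the ratio of consecutive values of `fszR`. -/
noncomputable def pochRatio (n : ℕ) (δ t : ℝ) : ℝ :=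
  ∏ j ∈ range (n + 1), ((t + j) / (t + δ + j))

theorem pochRatio_le_one {n : ℕ} {δ t : ℝ} (hδ : 0 ≤ δ) (ht : 0 < t) : pochRatio n δ t ≤ 1 :=
  prod_le_one (fun j _ => by positivity) fun j _ => by
    rw [div_le_one (by positivity)]
    linarith

theorem pochRatio_mono {n : ℕ} {δ t t' : ℝ} (hδ : 0 ≤ δ) (ht : 0 < t) (h : t ≤ t') :
    pochRatio n δ t ≤ pochRatio n δ t' :=
  prod_le_prod (fun j _ => by positivity) fun j _ => by
    have ht' : 0 < t' := by linarith
    rw [div_le_div_iff₀ (by positivity) (by positivity)]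
    nlinarith

theorem le_pochRatio {n : ℕ} {δ t : ℝ} (hδ : 0 ≤ δ) (hδ1 : δ ≤ 1) (hn : 0 < n) (ht : n ≤ t) :
    1 / 3 ≤ pochRatio n δ t := by
  have hn1 : (1 : ℝ) ≤ n := by exact_mod_cast hn
  have ht0 : 0 < t := by linarith
  have h1 : ∏ j ∈ range (n + 1), ((t + j) / (t + 1 + j)) ≤ pochRatio n δ t :=
    prod_le_prod (fun j _ => by positivity) fun j _ => by
      rw [div_le_div_iff₀ (by positivity) (by positivity)]
      nlinarith [show (0 : ℝ) ≤ j by positivity]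
  refine le_trans ?_ h1
  rw [prod_div_distrib, div_le_div_iff₀ (by positivity) (by positivity)]
  have h2 := prod_range_add_one_add_mul t (n + 1)
  have h3 : 0 < ∏ j ∈ range (n + 1), (t + 1 + (j : ℝ)) := by positivity
  have h4 : 0 < ∏ j ∈ range (n + 1), (t + (j : ℝ)) := by positivity
  push_cast at h2
  refine le_of_mul_le_mul_right ?_ ht0
  calc _ = 1 * ((∏ j ∈ range (n + 1), (t + 1 + (j : ℝ))) * t) := by ring
    _ = (∏ j ∈ range (n + 1), (t + (j : ℝ))) * (t + (n + 1)) := by rw [h2, one_mul]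
    _ ≤ (∏ j ∈ range (n + 1), (t + (j : ℝ))) * (3 * t) := by gcongr; linarith
    _ = _ := by ring

theorem fszR_add_one_div {n D s : ℕ} (hD : 0 < D) {t : ℝ} (ht : n < t) :
    fszR n D s (t + 1 / D) = fszR n D s t *
      ((1 + ((3 * D * n + 1 : ℕ) : ℝ) / (D * (t - n))) * pochRatio n (1 / D) t ^ (s + 1)) := by
  have ht0 : 0 < t := lt_of_le_of_lt (by positivity) ht
  have hD' : (0 : ℝ) < D := by positivity
  have hx : 0 < (D : ℝ) * (t - n) := mul_pos hD' (by linarith)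
  have h1 := prod_range_add_one_add_mul (D * (t - n)) (3 * D * n + 1)
  have e : (D : ℝ) * (t + 1 / D - n) = D * (t - n) + 1 := by field_simp; ring
  rw [fszR, fszR, e, pochRatio, prod_div_distrib, div_pow, eq_div_of_mul_eq hx.ne' h1]
  have hQ : 0 < ∏ j ∈ range (n + 1), (t + (j : ℝ)) := by positivity
  have hQ' : 0 < ∏ j ∈ range (n + 1), (t + 1 / D + (j : ℝ)) := by positivity
  generalize ∏ j ∈ range (n + 1), (t + (j : ℝ)) = Q at *
  generalize ∏ j ∈ range (n + 1), (t + 1 / D + (j : ℝ)) = Q' at *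
  generalize (D : ℝ) * (t - n) = x at *
  generalize ∏ j ∈ range (3 * D * n + 1), (x + (j : ℝ)) = P at *
  field_simp

theorem fszR_pos {n D s : ℕ} (hD : 0 < D) {t : ℝ} (ht : n < t) : 0 < fszR n D s t := by
  have ht0 : 0 < t := lt_of_le_of_lt (by positivity) ht
  have hx : 0 < (D : ℝ) * (t - n) := mul_pos (by positivity) (by linarith)
  unfold fszR
  positivity

theorem eventually_abs_tsum_fszR_sub_le {D s : ℕ} (hD : 0 < D) (hs : 3 * D ≤ s) {ε : ℝ}
    (hε : 0 < ε) : ∀ᶠ n : ℕ in atTop, ∃ U : ℝ, 0 < U ∧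
      U ≤ (3 * D) ^ (3 * D * n + 1) * (2 / 4 ^ n) ^ (s + 1 - 3 * D) * (D ^ 2 * zetaVal 2) ∧
      ∀ j, 0 < j → j ≤ D → |∑' m : ℕ, fszR n D s (m + (j : ℝ) / D) - U / D| ≤ ε * U := by
  have hD' : (0 : ℝ) < D := by positivity
  set β : ℝ := (1 / 3) ^ (s + 1) with hβ
  have hβ0 : 0 < β := by positivity
  have hN : Tendsto (fun n : ℕ => ((3 * D * n + 1 : ℕ) : ℝ)) atTop atTop :=
    tendsto_natCast_atTop_atTop.comp (tendsto_atTop_mono (fun n => by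
      show n ≤ 3 * D * n + 1
      nlinarith) tendsto_id)
  have hlim : Tendsto (fun n : ℕ => 2 * (ε / 2 / 2 + (3 / (β ^ 2 * ((3 * D * n + 1 : ℕ) : ℝ)) +
      1 / (β * ((3 * D * n + 1 : ℕ) : ℝ))) / (2 * (ε / 2)))) atTop
      (𝓝 (2 * (ε / 2 / 2 + (0 + 0) / (2 * (ε / 2))))) :=
    ((((tendsto_const_nhds.div_atTop (hN.const_mul_atTop (by positivity))).add
      (tendsto_const_nhds.div_atTop (hN.const_mul_atTop hβ0))).div_const _).const_add _).const_mul _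
  have hlt : 2 * (ε / 2 / 2 + (0 + 0) / (2 * (ε / 2))) < ε := by
    rw [add_zero, zero_div]
    linarith
  filter_upwards [hlim.eventually_lt_const hlt, eventually_gt_atTop 0] with n hnε hn
  set u : ℕ → ℝ := fun h => fszR n D s (n + ((h : ℝ) + 1) / D) with hu
  have ht : ∀ h : ℕ, (n : ℝ) < n + ((h : ℝ) + 1) / D := fun h => by
    have : 0 < ((h : ℝ) + 1) / D := by positivity
    linarith
  have ht0 : ∀ h : ℕ, (0 : ℝ) < n + ((h : ℝ) + 1) / D := fun h => by positivity
  have hz := (hasSum_zetaVal (i := 2) le_rfl).mul_left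
    ((3 * D : ℝ) ^ (3 * D * n + 1) * (2 / 4 ^ n) ^ (s + 1 - 3 * D) * D ^ 2)
  have hule : ∀ h, u h ≤ (3 * D : ℝ) ^ (3 * D * n + 1) * (2 / 4 ^ n) ^ (s + 1 - 3 * D) * D ^ 2 *
      (1 / ((h : ℝ) + 1) ^ 2) := fun h => by
    refine (fszR_le hn hD hs (ht h).le).trans ?_
    rw [mul_assoc _ ((D : ℝ) ^ 2)]
    refine mul_le_mul_of_nonneg_left ?_ (by positivity)
    calc 1 / ((n : ℝ) + ((h : ℝ) + 1) / D) ^ 2 ≤ 1 / (((h : ℝ) + 1) / D) ^ 2 := by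
          gcongr
          linarith [show (0 : ℝ) ≤ n by positivity]
      _ = _ := by field_simp
  have hu0 : ∀ h, 0 < u h := fun h => fszR_pos hD (ht h)
  have hus : Summable u := Summable.of_nonneg_of_le (fun h => (hu0 h).le) hule hz.summable
  obtain ⟨T, hT, hTle⟩ := exists_hasSum_abs_sub_le (u := u) (U := ∑' h, u h)
    (N := ((3 * D * n + 1 : ℕ) : ℝ)) (β := β) (η := ε / 2)
    (B := fun h => pochRatio n (1 / D) (n + ((h : ℝ) + 1) / D) ^ (s + 1))
    (fun h => (hu0 h).le) hus.hasSum (by positivity) hβ0 (by positivity)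
    (fun a b hab => by
      refine pow_le_pow_left₀ (prod_nonneg fun j _ => by positivity)
        (pochRatio_mono (by positivity) (ht0 a) ?_) _
      have : (a : ℝ) ≤ b := by exact_mod_cast hab
      gcongr)
    (fun h => pow_le_pow_left₀ (by positivity) (le_pochRatio (by positivity) (by
      rw [div_le_one hD']
      exact_mod_cast hD) hn (ht h).le) _)
    (fun h => pow_le_one₀ (prod_nonneg fun j _ => by positivity)
      (pochRatio_le_one (by positivity) (ht0 h)))
    (fun h => by
      have e1 := fszR_add_one_div (s := s) hD (ht h)
      have e2 : (n : ℝ) + ((h : ℝ) + 1) / D + 1 / D = n + (((h + 1 : ℕ) : ℝ) + 1) / D := by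
        push_cast
        ring
      have e3 : (D : ℝ) * ((n : ℝ) + ((h : ℝ) + 1) / D - n) = h + 1 := by field_simp; ring
      rw [e2, e3] at e1
      exact e1)
  have hU : 0 < ∑' h, u h := hus.tsum_pos (fun h => (hu0 h).le) 0 (hu0 0)
  refine ⟨∑' h, u h, hU, ?_, fun j hj hjD => ?_⟩
  · have := hasSum_le hule hus.hasSum hz
    rwa [mul_assoc _ _ (zetaVal 2)] at this
  · have h1 := abs_tsum_residue_sub_le hus.hasSum hT (show j - 1 < D by omega)
    have h2 : ∑' m : ℕ, fszR n D s (m + (j : ℝ) / D) = ∑' m : ℕ, u (m * D + (j - 1)) := by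
      rw [← (summable_fszR hn hj hjD hs).sum_add_tsum_nat_add n, sum_eq_zero fun m hm =>
        fszR_add_div_eq_zero (mem_range.1 hm) hjD hD, zero_add]
      refine tsum_congr fun m => ?_
      rw [hu]
      congr 1
      push_cast [Nat.cast_sub hj]
      field_simp
      ring
    rw [h2]
    calc _ ≤ 2 * T := h1
      _ ≤ 2 * ((ε / 2 / 2 + (3 / (β ^ 2 * ((3 * D * n + 1 : ℕ) : ℝ)) +
          1 / (β * ((3 * D * n + 1 : ℕ) : ℝ))) / (2 * (ε / 2))) * ∑' h, u h) := by gcongr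
      _ = 2 * (ε / 2 / 2 + (3 / (β ^ 2 * ((3 * D * n + 1 : ℕ) : ℝ)) +
          1 / (β * ((3 * D * n + 1 : ℕ) : ℝ))) / (2 * (ε / 2))) * ∑' h, u h := by ring
      _ ≤ _ := mul_le_mul_of_nonneg_right hnε.le hU.le

theorem sum_range_tsum_one_div_add_div_pow {e i : ℕ} (he : 0 < e) (hi : 2 ≤ i) :
    ∑ j ∈ range e, ∑' m : ℕ, 1 / ((m : ℝ) + ((j : ℝ) + 1) / e) ^ i = e ^ i * zetaVal i := by
  rw [← (hasSum_zetaVal hi).sum_residue he, mul_sum]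
  refine sum_congr rfl fun j _ => ?_
  rw [← tsum_mul_left]
  refine tsum_congr fun m => ?_
  push_cast
  field_simp
  rw [← mul_pow]
  congr 1
  field_simp
  ring

open Polynomial in
theorem signVariations_lt_card_support {P : ℚ[X]} (hP : P ≠ 0) :
    P.signVariations < #P.support := by
  induction h : #P.support using Nat.strong_induction_on generalizing P with
  | _ k ih =>
    subst h
    by_cases h0 : P.eraseLead = 0
    · have h1 := P.eraseLead_add_monomial_natDegree_leadingCoeff
      rw [h0, zero_add] at h1
      rw [← h1, signVariations_monomial, h1]
      exact card_pos.2 (nonempty_support_iff.2 hP)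
    · have h1 := ih _ (eraseLead_support_card_lt hP) h0 rfl
      have h2 := signVariations_le_eraseLead_succ (P := P)
      have h3 := card_support_eraseLead (f := P)
      omega

open Polynomial in
theorem card_lt_card_support_of_roots {P : ℚ[X]} (hP : P ≠ 0) {S : Finset ℕ}
    (hS : ∀ e ∈ S, 0 < e ∧ P.eval (e : ℚ) = 0) : #S < #P.support := by
  refine lt_of_le_of_lt ?_ (signVariations_lt_card_support hP)
  refine le_trans ?_ (roots_countP_pos_le_signVariations P)
  rw [Multiset.countP_eq_card_filter, ← card_image_of_injective S (Nat.cast_injective (R := ℚ))]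
  refine Multiset.card_le_card ((Multiset.le_iff_subset (nodup _)).2 fun x hx => ?_)
  rw [Finset.mem_val] at hx
  obtain ⟨e, he, rfl⟩ := mem_image.1 hx
  rw [Multiset.mem_filter, mem_roots hP]
  exact ⟨(hS e he).2, by exact_mod_cast (hS e he).1⟩

theorem exists_weights_rat {S I : Finset ℕ} (hS : ∀ e ∈ S, 0 < e) (hI : 1 ∉ I) (h : #I < #S) :
    ∃ w : ℕ → ℚ, (∀ i ∈ I, ∑ e ∈ S, w e * e ^ i = 0) ∧ ∑ e ∈ S, w e * e ≠ 0 := by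
  classical
  set v : ℕ → S → ℚ := fun i e => (e : ℚ) ^ i with hv
  have hnot : v 1 ∉ Submodule.span ℚ (v '' I) := by
    rw [Submodule.mem_span_image_finset_iff_exists_fun]
    rintro ⟨c, hc⟩
    open Polynomial in
    set P : ℚ[X] := X - ∑ i : I, monomial (i : ℕ) (c i) with hP
    have h1 : P.coeff 1 = 1 := by
      rw [hP, Polynomial.coeff_sub, Polynomial.coeff_X_one, Polynomial.finsetSum_coeff,
        sum_eq_zero, sub_zero]
      intro i _
      rw [Polynomial.coeff_monomial, if_neg]
      rintro h
      exact hI (h ▸ i.2)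
    have hP0 : P ≠ 0 := by
      rintro h
      rw [h] at h1
      simp at h1
    have h2 : P.support ⊆ insert 1 I := by
      intro k hk
      rw [mem_insert]
      by_contra! hk'
      refine Polynomial.mem_support_iff.1 hk ?_
      rw [hP, Polynomial.coeff_sub, Polynomial.coeff_X, if_neg hk'.1.symm,
        Polynomial.finsetSum_coeff, sum_eq_zero, sub_zero]
      intro i _
      rw [Polynomial.coeff_monomial, if_neg]
      rintro h
      exact hk'.2 (h ▸ i.2)
    have h3 := card_lt_card_support_of_roots hP0 (S := S) fun e he => ⟨hS e he, by
      have := congrFun hc ⟨e, he⟩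
      simp only [hv, Finset.sum_apply, Pi.smul_apply, smul_eq_mul, pow_one] at this
      simp only [hP, Polynomial.eval_sub, Polynomial.eval_X, Polynomial.eval_finsetSum,
        Polynomial.eval_monomial]
      linarith⟩
    have h4 := (card_le_card h2).trans (card_insert_le _ _)
    omega
  obtain ⟨f, hf, hfI⟩ := Submodule.exists_dual_map_eq_bot_of_notMem hnot inferInstance
  have key : ∀ i, ∑ e ∈ S, (if h : e ∈ S then f (Pi.single ⟨e, h⟩ 1) else 0) * (e : ℚ) ^ i =
      f (v i) := by
    intro i
    rw [f.pi_apply_eq_sum_univ, ← sum_coe_sort]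
    refine sum_congr rfl fun e _ => ?_
    rw [dif_pos e.2, smul_eq_mul, mul_comm]
    congr 2
    funext k
    simp [Pi.single_apply, eq_comm]
  refine ⟨fun e => if h : e ∈ S then f (Pi.single ⟨e, h⟩ 1) else 0, fun i hi => ?_, ?_⟩
  · rw [key]
    have : f (v i) ∈ Submodule.map f (Submodule.span ℚ (v '' I)) :=
      Submodule.mem_map_of_mem (Submodule.subset_span ⟨i, hi, rfl⟩)
    rwa [hfI, Submodule.mem_bot] at this
  · have := key 1
    simp only [pow_one] at this
    rwa [this]

theorem exists_weights {S I : Finset ℕ} (hS : ∀ e ∈ S, 0 < e) (hI : 1 ∉ I) (h : #I < #S) :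
    ∃ w : ℕ → ℤ, (∀ i ∈ I, ∑ e ∈ S, w e * (e : ℤ) ^ i = 0) ∧ ∑ e ∈ S, w e * (e : ℤ) ≠ 0 := by
  obtain ⟨w, h1, h2⟩ := exists_weights_rat hS hI h
  set q : ℕ := ∏ e ∈ S, (w e).den with hq
  have hq0 : (q : ℚ) ≠ 0 := by
    rw [hq]
    exact_mod_cast prod_ne_zero_iff.2 fun e _ => (w e).den_nz
  have hz : ∀ e ∈ S, ∃ z : ℤ, (z : ℚ) = q * w e := by
    intro e he
    obtain ⟨k, hk⟩ := dvd_prod_of_mem (fun e => (w e).den) he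
    refine ⟨k * (w e).num, ?_⟩
    rw [hq, hk]
    push_cast
    rw [mul_comm ((w e).den : ℚ), mul_assoc, Rat.den_mul_eq_num]
  choose! z hz using hz
  have key : ∀ i, ((∑ e ∈ S, z e * (e : ℤ) ^ i : ℤ) : ℚ) = q * ∑ e ∈ S, w e * (e : ℚ) ^ i := by
    intro i
    push_cast
    rw [mul_sum]
    exact sum_congr rfl fun e he => by rw [hz e he, mul_assoc]
  refine ⟨z, fun i hi => ?_, fun h0 => h2 ?_⟩
  · have := key i
    rw [h1 i hi, mul_zero] at this
    exact_mod_cast this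
  · have := key 1
    simp only [pow_one] at this
    rw [h0, Int.cast_zero, zero_eq_mul] at this
    exact this.resolve_left hq0

theorem exists_common_den (J : Finset ℕ) (x : ℕ → ℝ) : ∃ q : ℕ, 0 < q ∧
    ∀ i ∈ J, ¬ Irrational (x i) → (q : ℝ) * x i ∈ (Int.castRingHom ℝ).range := by
  classical
  induction J using Finset.induction_on with
  | empty => exact ⟨1, one_pos, by simp⟩
  | insert a J _ ih =>
    obtain ⟨q, hq, h⟩ := ih
    have hmul : ∀ k : ℕ, ∀ i ∈ J, ¬ Irrational (x i) →
        ((q * k : ℕ) : ℝ) * x i ∈ (Int.castRingHom ℝ).range := fun k i hi hx => by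
      have := mul_mem (natCast_mem (Int.castRingHom ℝ).range k) (h i hi hx)
      push_cast
      convert this using 1
      ring
    by_cases ha : Irrational (x a)
    · refine ⟨q, hq, fun i hi hx => ?_⟩
      rcases mem_insert.1 hi with rfl | hi
      · exact absurd ha hx
      · exact h i hi hx
    · obtain ⟨r, hr⟩ := not_not.1 ha
      refine ⟨q * r.den, Nat.mul_pos hq r.den_pos, fun i hi hx => ?_⟩
      rcases mem_insert.1 hi with rfl | hi
      · have h1 : (r.den : ℝ) * r = r.num := by exact_mod_cast Rat.den_mul_eq_num r
        rw [← hr, Nat.cast_mul, mul_assoc, h1]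
        exact mul_mem (natCast_mem _ q) (intCast_mem _ r.num)
      · exact hmul _ i hi hx

/-- The linear combination of the series `∑ m, fszR n D s (m + j / D)` attached to weights
on the divisors of `D`. -/
noncomputable def fszForm (n D s : ℕ) (w : ℕ → ℤ) : ℝ :=
  ∑ e ∈ D.divisors, w e * ∑ j ∈ range e, ∑' m : ℕ, fszR n D s (m + (((j + 1) *
      (D / e) : ℕ) : ℝ) / D)

theorem mul_div_pos_le {D e j : ℕ} (he : e ∈ D.divisors) (hj : j ∈ range e) :
    0 < (j + 1) * (D / e) ∧ (j + 1) * (D / e) ≤ D := by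
  obtain ⟨hdvd, hD⟩ := Nat.mem_divisors.1 he
  obtain ⟨k, rfl⟩ := hdvd
  have he0 : 0 < e := Nat.pos_of_ne_zero (by rintro rfl; simp at hD)
  have hk : 0 < k := Nat.pos_of_ne_zero (by rintro rfl; simp at hD)
  rw [Nat.mul_div_cancel_left _ he0]
  exact ⟨by positivity, Nat.mul_le_mul_right k (mem_range.1 hj)⟩

theorem mul_fszForm_mem_range {n d D s : ℕ} (hn : 0 < n) (hn2 : Even n) (hD : 0 < D)
    (hs : 3 * D ≤ s) (hs2 : Odd s) (hd0 : d ≠ 0) (hd : ∀ j, 0 < j → j ≤ n → j ∣ d) {w : ℕ → ℤ}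
    {q : ℕ} (hq : ∀ i ∈ (Icc 3 s).filter Odd, ¬ Irrational (zetaVal i) →
      (q : ℝ) * zetaVal i ∈ (Int.castRingHom ℝ).range)
    (hw : ∀ i ∈ (Icc 3 s).filter Odd, Irrational (zetaVal i) →
      ∑ e ∈ D.divisors, w e * (e : ℤ) ^ i = 0) :
    q * (2 * (d : ℝ) ^ (s + 1) * fszForm n D s w) ∈ (Int.castRingHom ℝ).range := by
  obtain ⟨N, M, h⟩ := exists_hasSum_fszR hn hn2 hD hs hs2 hd0 hd
  have hinner : ∀ e ∈ D.divisors, 2 * (d : ℝ) ^ (s + 1) * ∑ j ∈ range e,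
      ∑' m : ℕ, fszR n D s (m + (((j + 1) * (D / e) : ℕ) : ℝ) / D) =
      ∑ i ∈ (Icc 3 s).filter Odd, N i * (e ^ i * zetaVal i) -
        ∑ j ∈ range e, (M ((j + 1) * (D / e)) : ℝ) := by
    intro e he
    have he0 : 0 < e := Nat.pos_of_mem_divisors he
    have h1 : ∀ j ∈ range e, 2 * (d : ℝ) ^ (s + 1) *
        ∑' m : ℕ, fszR n D s (m + (((j + 1) * (D / e) : ℕ) : ℝ) / D) =
        ∑ i ∈ (Icc 3 s).filter Odd, N i * (∑' m : ℕ, 1 / ((m : ℝ) + ((j : ℝ) + 1) / e) ^ i) -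
          M ((j + 1) * (D / e)) := by
      intro j hj
      obtain ⟨h2, h3⟩ := mul_div_pos_le he hj
      have h4 : (((j + 1) * (D / e) : ℕ) : ℝ) / D = ((j : ℝ) + 1) / e := by
        have : (e : ℝ) ≠ 0 := by positivity
        have : (D : ℝ) ≠ 0 := by positivity
        push_cast [Nat.cast_div (Nat.dvd_of_mem_divisors he) ‹(e : ℝ) ≠ 0›]
        field_simp
      rw [← tsum_mul_left, (h _ h2 h3).tsum_eq, h4]
    rw [mul_sum, sum_congr rfl h1, sum_sub_distrib, sum_comm]
    congr 1
    refine sum_congr rfl fun i hi => ?_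
    rw [← mul_sum, sum_range_tsum_one_div_add_div_pow he0 (by
      have := mem_Icc.1 (mem_filter.1 hi).1
      omega)]
  have houter : q * (2 * (d : ℝ) ^ (s + 1) * fszForm n D s w) =
      ∑ i ∈ (Icc 3 s).filter Odd,
        N i * (q * zetaVal i * ((∑ e ∈ D.divisors, w e * (e : ℤ) ^ i : ℤ) : ℝ)) -
      q * ∑ e ∈ D.divisors, w e * ∑ j ∈ range e, (M ((j + 1) * (D / e)) : ℝ) := by
    have h1 : 2 * (d : ℝ) ^ (s + 1) * fszForm n D s w = ∑ e ∈ D.divisors, (w e : ℝ) *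
        (∑ i ∈ (Icc 3 s).filter Odd, N i * (e ^ i * zetaVal i) -
          ∑ j ∈ range e, (M ((j + 1) * (D / e)) : ℝ)) := by
      rw [fszForm, mul_sum]
      refine sum_congr rfl fun e he => ?_
      rw [← hinner e he]
      ring
    rw [h1]
    simp only [mul_sub, sum_sub_distrib]
    congr 1
    simp only [mul_sum]
    rw [sum_comm]
    refine sum_congr rfl fun i _ => ?_
    push_cast
    simp only [mul_sum]
    exact sum_congr rfl fun e _ => by ring
  rw [houter]
  refine sub_mem (sum_mem fun i hi => mul_mem (intCast_mem _ _) ?_) (mul_mem (natCast_mem _ _)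
    (sum_mem fun e _ => mul_mem (intCast_mem _ _) (sum_mem fun j _ => intCast_mem _ _)))
  by_cases hi' : Irrational (zetaVal i)
  · rw [hw i hi hi', Int.cast_zero, mul_zero]
    exact zero_mem _
  · exact mul_mem (hq i hi hi') (intCast_mem _ _)

theorem abs_fszForm_sub_le {n D s : ℕ} {w : ℕ → ℤ} {U δ : ℝ}
    (h : ∀ j, 0 < j → j ≤ D → |∑' m : ℕ, fszR n D s (m + (j : ℝ) / D) - U / D| ≤ δ) :
    |fszForm n D s w - ((∑ e ∈ D.divisors, w e * (e : ℤ) : ℤ) : ℝ) * (U / D)| ≤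
      (∑ e ∈ D.divisors, |(w e : ℝ)| * e) * δ := by
  have h1 : fszForm n D s w - ((∑ e ∈ D.divisors, w e * (e : ℤ) : ℤ) : ℝ) * (U / D) =
      ∑ e ∈ D.divisors, w e * ∑ j ∈ range e,
        (∑' m : ℕ, fszR n D s (m + (((j + 1) * (D / e) : ℕ) : ℝ) / D) - U / D) := by
    rw [fszForm]
    push_cast
    rw [sum_mul, ← sum_sub_distrib]
    refine sum_congr rfl fun e _ => ?_
    rw [sum_sub_distrib, sum_const, card_range, nsmul_eq_mul]
    ring
  rw [h1, sum_mul]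
  refine (abs_sum_le_sum_abs _ _).trans (sum_le_sum fun e he => ?_)
  rw [abs_mul, mul_assoc]
  refine mul_le_mul_of_nonneg_left ?_ (abs_nonneg _)
  refine (abs_sum_le_sum_abs _ _).trans ((sum_le_card_nsmul _ _ δ fun j hj => ?_).trans ?_)
  · exact h _ (mul_div_pos_le he hj).1 (mul_div_pos_le he hj).2
  · simp

theorem tendsto_lcmUpto_pow_mul {D s : ℕ} (hs : 3 * D ≤ s)
    (h : (12 * D : ℝ) ^ (3 * D) * 3.1 ^ (s + 1) < 4 ^ (s + 1)) (c : ℝ) :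
    Tendsto (fun n : ℕ => (Nat.lcmUpto n : ℝ) ^ (s + 1) *
      ((3 * D) ^ (3 * D * n + 1) * (2 / 4 ^ n) ^ (s + 1 - 3 * D) * c)) atTop (𝓝 0) := by
  obtain ⟨K, hK, hle⟩ := exists_lcmUpto_le
  obtain ⟨e, he⟩ : ∃ e, s + 1 - 3 * D = e := ⟨_, rfl⟩
  have hse : s + 1 = 3 * D + e := by omega
  have hr : (3 * D : ℝ) ^ (3 * D) * 3.1 ^ (s + 1) / 4 ^ e < 1 := by
    rw [div_lt_one (by positivity)]
    have h4 : (0 : ℝ) < 4 ^ (3 * D) := by positivity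
    refine lt_of_mul_lt_mul_left ?_ h4.le
    rw [← pow_add, ← hse]
    refine lt_of_eq_of_lt ?_ h
    rw [← mul_assoc, ← mul_pow]
    congr 2
    ring
  have hlim := (tendsto_pow_atTop_nhds_zero_of_lt_one (by positivity) hr).const_mul
    (K ^ (s + 1) * (3 * D) * 2 ^ e * |c|)
  rw [mul_zero] at hlim
  refine squeeze_zero_norm (fun n => ?_) hlim
  rw [he, norm_mul, norm_mul, Real.norm_of_nonneg (by positivity),
      Real.norm_of_nonneg (by positivity),
    Real.norm_eq_abs]
  calc (Nat.lcmUpto n : ℝ) ^ (s + 1) * ((3 * D) ^ (3 * D * n + 1) * (2 / 4 ^ n) ^ e * |c|)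
      ≤ (K * 3.1 ^ n) ^ (s + 1) * ((3 * D) ^ (3 * D * n + 1) * (2 / 4 ^ n) ^ e * |c|) := by
        gcongr
        exact hle n
    _ = _ := by
        simp only [mul_pow, div_pow, ← pow_mul]
        ring

theorem card_divisors_le_of_lt {D s : ℕ} (hD : 0 < D) (hs : 3 * D ≤ s) (hs2 : Odd s)
    (h : (12 * D : ℝ) ^ (3 * D) * 3.1 ^ (s + 1) < 4 ^ (s + 1)) :
    D.divisors.card ≤ {i : ℕ | Odd i ∧ 3 ≤ i ∧ i ≤ s ∧ Irrational (zetaVal i)}.ncard := by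
  classical
  have hset : {i : ℕ | Odd i ∧ 3 ≤ i ∧ i ≤ s ∧ Irrational (zetaVal i)} =
      (((Icc 3 s).filter Odd).filter fun i => Irrational (zetaVal i) : Finset ℕ) := by
    ext i
    simp only [Set.mem_ofPred_eq, coe_filter, mem_filter, mem_Icc]
    tauto
  rw [hset, Set.ncard_coe_finset]
  by_contra! hlt
  obtain ⟨w, hw, hW⟩ := exists_weights (fun e he => Nat.pos_of_mem_divisors he)
    (fun h => by simp at h) hlt
  obtain ⟨q, hq0, hq⟩ := exists_common_den ((Icc 3 s).filter Odd) zetaVal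
  set W : ℤ := ∑ e ∈ D.divisors, w e * (e : ℤ) with hWdef
  set A : ℝ := ∑ e ∈ D.divisors, |(w e : ℝ)| * e with hA
  have hD' : (0 : ℝ) < D := by positivity
  have hW1 : (1 : ℝ) ≤ |(W : ℝ)| := by exact_mod_cast Int.one_le_abs hW
  have hA0 : 0 ≤ A := by positivity
  have hε : 0 < 1 / ((A + 1) * (2 * D)) := by positivity
  obtain ⟨n, ⟨⟨U, hU, hUle, hS⟩, hsmall, hn⟩, hn2⟩ :=
    (((eventually_abs_tsum_fszR_sub_le hD hs hε).and
      (((tendsto_lcmUpto_pow_mul hs h (D ^ 2 * zetaVal 2)).eventually_lt_const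
        (show (0 : ℝ) < 1 / (q * 2 * ((|(W : ℝ)| + 1) / D)) by positivity)).and
        (eventually_gt_atTop 0))).and_frequently Nat.frequently_even).exists
  have hd0 := Nat.lcmUpto_pos n
  have h_int := mul_fszForm_mem_range (w := w) hn hn2 hD hs hs2 hd0.ne'
    (fun j h0 h1 => dvd_lcm (f := id) (mem_Icc.2 ⟨h0, h1⟩)) hq
    (fun i hi hx => hw i (mem_filter.2 ⟨hi, hx⟩))
  have hform := abs_fszForm_sub_le (w := w) hS
  rw [← hWdef, ← hA] at hform
  have hAU : A * (1 / ((A + 1) * (2 * D)) * U) < U / D := by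
    have h1 : A * (1 / ((A + 1) * (2 * D)) * U) = A / (A + 1) / 2 * (U / D) := by
      field_simp
    have h2 : A / (A + 1) ≤ 1 := by
      rw [div_le_one (by positivity)]
      linarith
    have h3 : 0 < U / D := by positivity
    rw [h1]
    nlinarith
  have hWU : U / D ≤ |(W : ℝ) * (U / D)| := by
    rw [abs_mul, abs_of_pos (show 0 < U / D by positivity)]
    exact le_mul_of_one_le_left (by positivity) hW1
  have hne : fszForm n D s w ≠ 0 := by
    intro h0
    rw [h0, zero_sub, abs_neg] at hform
    linarith
  have hle : |fszForm n D s w| ≤ (|(W : ℝ)| + 1) / D * U := by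
    have h1 := abs_sub_abs_le_abs_sub (fszForm n D s w) ((W : ℝ) * (U / D))
    rw [abs_mul, abs_of_pos (show 0 < U / D by positivity)] at h1
    calc |fszForm n D s w| ≤ |(W : ℝ)| * (U / D) + U / D := by linarith
      _ = _ := by ring
  obtain ⟨z, hz⟩ := h_int
  rw [eq_intCast] at hz
  have hz0 : z ≠ 0 := by
    rintro rfl
    rw [Int.cast_zero, eq_comm] at hz
    have : (Nat.lcmUpto n : ℝ) ≠ 0 := by positivity
    have : (q : ℝ) ≠ 0 := by positivity
    simp_all
  have hz1 : (1 : ℝ) ≤ |(z : ℝ)| := by exact_mod_cast Int.one_le_abs hz0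
  refine absurd hz1 (not_le.2 ?_)
  rw [hz, abs_mul, abs_mul, abs_of_nonneg (by positivity), abs_of_nonneg (by positivity)]
  rw [lt_div_iff₀ (by positivity)] at hsmall
  refine lt_of_le_of_lt ?_ hsmall
  calc q * (2 * (Nat.lcmUpto n : ℝ) ^ (s + 1) * |fszForm n D s w|)
      ≤ q * (2 * (Nat.lcmUpto n : ℝ) ^ (s + 1) * ((|(W : ℝ)| + 1) / D *
        ((3 * D) ^ (3 * D * n + 1) * (2 / 4 ^ n) ^ (s + 1 - 3 * D) * (D ^ 2 * zetaVal 2)))) := by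
        have := mul_le_mul_of_nonneg_left hUle (show 0 ≤ (|(W : ℝ)| + 1) / D by positivity)
        gcongr
        exact hle.trans this
    _ = _ := by ring

theorem pow_mul_pow_lt_of_le {D s : ℕ} (hD : 2 ≤ D) (h : 100 * (D * Real.log D) ≤ s) :
    (12 * D : ℝ) ^ (3 * D) * 3.1 ^ (s + 1) < 4 ^ (s + 1) := by
  have hD' : (2 : ℝ) ≤ D := by exact_mod_cast hD
  have hlog : 0 < Real.log D := Real.log_pos (by linarith)
  have h1 : Real.log (12 * D) ≤ 5 * Real.log D := by
    have : Real.log (12 * D) ≤ Real.log ((D : ℝ) ^ 5) := Real.log_le_log (by positivity) (by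
      have : (2 : ℝ) ^ 4 ≤ D ^ 4 := by gcongr
      nlinarith)
    rwa [Real.log_pow] at this
  have h2 : (0.225 : ℝ) ≤ Real.log 4 - Real.log 3.1 := by
    rw [← Real.log_div (by norm_num) (by norm_num)]
    refine le_trans ?_ (Real.one_sub_inv_le_log_of_pos (by norm_num))
    norm_num
  rw [← Real.log_lt_log_iff (by positivity) (by positivity),
    Real.log_mul (by positivity) (by positivity), Real.log_pow, Real.log_pow, Real.log_pow]
  push_cast
  have h3 := mul_le_mul_of_nonneg_left h1 (show (0 : ℝ) ≤ 3 * D by positivity)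
  have h4 := mul_le_mul_of_nonneg_left h2 (show (0 : ℝ) ≤ (s : ℝ) + 1 by positivity)
  have h5 : 0 < D * Real.log D := by positivity
  nlinarith

end

theorem stmt18 :
    ∃ C : ℝ, 0 < C ∧ ∀ s D : ℕ, 0 < s → 0 < D → Odd s → 3 * D ≤ s →
      (D = 1 ∨ C ≤ (s : ℝ) / (D * Real.log D)) →
      D.divisors.card ≤ {i : ℕ | Odd i ∧ 3 ≤ i ∧ i ≤ s ∧ Irrational (zetaVal i)}.ncard := by
  refine ⟨100, by norm_num, fun s D _ hD hs2 hs h => ?_⟩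
  by_cases h1 : D = 1
  · subst h1
    rw [Nat.divisors_one, Finset.card_singleton, Nat.one_le_iff_ne_zero]
    refine Set.ncard_ne_zero_of_mem (a := 3) ⟨by decide, le_rfl, by omega, irrational_zetaVal_three⟩
      ((Set.finite_Icc 3 s).subset fun i hi => ⟨hi.2.1, hi.2.2.1⟩)
  · have hD2 : 2 ≤ D := by omega
    have hlog : 0 < Real.log D := Real.log_pos (by exact_mod_cast hD2)
    refine card_divisors_le_of_lt hD hs hs2 (pow_mul_pow_lt_of_le hD2 ?_)
    exact (le_div_iff₀ (by positivity)).1 (h.resolve_left h1)
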